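/- Fix α ∈ (0,1), and suppose that the orbit (a_t u_α x₀)_{t≥0} is equidistributed in X = SL_2(ℝ)/Λ with respect to the SL_2(ℝ)-invariant Borel probability measure m, where Λ is the image of SL_2(ℤ). Then the orbit (𝒢^n α)_{n∈ℕ} of α under the Gauss map is equidistributed with respect to the Gauss measure: for every bounded continuous f : ℝ → ℝ, (1/N)Σ_{n=0}^{N−1} f(𝒢^n α) → (1/log 2)∫₀¹ f(x)/(1+x) dx as N → ∞. -/

import Mathlib

open Matrix MeasureTheory Filter Topology

noncomputable section

abbrev SL (n : ℕ) := Matrix.SpecialLinearGroup (Fin n) ℝ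

instance (n : ℕ) : TopologicalSpace (SL n) :=
  TopologicalSpace.induced (fun g => (g : Matrix (Fin n) (Fin n) ℝ)) inferInstance

/-- The image of `SL_2(ℤ)` in `SL_2(ℝ)`. -/
def SLZ (n : ℕ) : Subgroup (SL n) :=
  (Matrix.SpecialLinearGroup.map (n := Fin n) (Int.castRingHom ℝ)).range

instance (n : ℕ) : MeasurableSpace (SL n ⧸ SLZ n) := borel _
instance (n : ℕ) : BorelSpace (SL n ⧸ SLZ n) := ⟨rfl⟩

/-- The Gauss map `𝒢(x) = 1/x − ⌊1/x⌋` (with `𝒢(0) = 0`). -/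
def gaussMap (x : ℝ) : ℝ := Int.fract x⁻¹

/-! ### Part 1 : topology of `SL 2` -/

instance slTopGroup : IsTopologicalGroup (SL 2) :=
  Matrix.SpecialLinearGroup.topologicalGroup (n := Fin 2) (R := ℝ)

theorem sl_isClosedEmbedding :
    IsClosedEmbedding (fun g : SL 2 => (g : Matrix (Fin 2) (Fin 2) ℝ)) :=
  Matrix.SpecialLinearGroup.isClosedEmbedding_val (n := Fin 2) (R := ℝ)

instance : LocallyCompactSpace (Matrix (Fin 2) (Fin 2) ℝ) :=
  inferInstanceAs (LocallyCompactSpace (Fin 2 → Fin 2 → ℝ))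

instance : SecondCountableTopology (Matrix (Fin 2) (Fin 2) ℝ) :=
  inferInstanceAs (SecondCountableTopology (Fin 2 → Fin 2 → ℝ))

instance slLC : LocallyCompactSpace (SL 2) := sl_isClosedEmbedding.locallyCompactSpace
instance slT2 : T2Space (SL 2) := sl_isClosedEmbedding.isEmbedding.t2Space
instance slSC : SecondCountableTopology (SL 2) :=
  sl_isClosedEmbedding.isEmbedding.secondCountableTopology

instance slMS : MeasurableSpace (SL 2) := borel _
instance slBS : BorelSpace (SL 2) := ⟨rfl⟩

theorem sl_continuous_entry (i j : Fin 2) :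
    Continuous (fun g : SL 2 => (g : Matrix (Fin 2) (Fin 2) ℝ) i j) :=
  sl_isClosedEmbedding.continuous.matrix_elem i j

theorem sl_continuous_iff {Y : Type*} [TopologicalSpace Y] (f : Y → SL 2) :
    Continuous f ↔ ∀ i j, Continuous (fun y => (f y : Matrix (Fin 2) (Fin 2) ℝ) i j) := by
  rw [sl_isClosedEmbedding.isEmbedding.continuous_iff]
  constructor
  · intro h i j
    exact h.matrix_elem i j
  · intro h
    exact continuous_matrix h

/-- a set of bounded matrices -/
def slBox (M : ℝ) : Set (SL 2) := {g | ∀ i j, |(g : Matrix (Fin 2) (Fin 2) ℝ) i j| ≤ M}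

theorem slBox_compact (M : ℝ) : IsCompact (slBox M) := by
  have h : IsCompact (Set.pi Set.univ (fun _ : Fin 2 => Set.pi Set.univ
      (fun _ : Fin 2 => Set.Icc (-M) M)) : Set (Matrix (Fin 2) (Fin 2) ℝ)) :=
    isCompact_univ_pi (fun _ => isCompact_univ_pi (fun _ => isCompact_Icc))
  have := sl_isClosedEmbedding.isCompact_preimage h
  convert this using 1
  ext g
  constructor
  · intro h i _ j _
    exact abs_le.1 (h i j)
  · intro h i j
    exact abs_le.2 (h i (Set.mem_univ _) j (Set.mem_univ _))

theorem compact_subset_slBox {K : Set (SL 2)} (hK : IsCompact K) : ∃ M, 0 < M ∧ K ⊆ slBox M := by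
  have : ∀ i j : Fin 2, ∃ M, ∀ g ∈ K, |(g : Matrix (Fin 2) (Fin 2) ℝ) i j| ≤ M := by
    intro i j
    obtain ⟨M, hM⟩ := hK.exists_bound_of_continuousOn (sl_continuous_entry i j).continuousOn
    exact ⟨M, hM⟩
  choose M hM using this
  refine ⟨1 + ∑ i, ∑ j, |M i j|, by positivity, fun g hg i j => (hM i j g hg).trans ?_⟩
  have h1 : |M i j| ≤ ∑ j, |M i j| :=
    Finset.single_le_sum (f := fun j => |M i j|) (fun _ _ => abs_nonneg _) (Finset.mem_univ j)
  have h2 : ∑ j, |M i j| ≤ ∑ i, ∑ j, |M i j| :=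
    Finset.single_le_sum (f := fun i => ∑ j, |M i j|)
      (fun _ _ => Finset.sum_nonneg (fun _ _ => abs_nonneg _)) (Finset.mem_univ i)
  linarith [le_abs_self (M i j)]

theorem hasCompactSupport_of_box {φ : SL 2 → ℝ} (M : ℝ) (h : ∀ g, φ g ≠ 0 → g ∈ slBox M) :
    HasCompactSupport φ :=
  HasCompactSupport.intro (slBox_compact M) (fun g hg => by
    by_contra h'
    exact hg (h g h'))

/-- Bounded integer matrices form a finite set. -/
theorem slz_finite (M : ℝ) : {γ : SLZ 2 | (γ : SL 2) ∈ slBox M}.Finite := by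
  have hfin : (Set.pi Set.univ (fun _ : Fin 2 => Set.pi Set.univ
      (fun _ : Fin 2 => Set.Icc (-⌈M⌉) ⌈M⌉)) : Set (Fin 2 → Fin 2 → ℤ)).Finite :=
    Set.Finite.pi' (fun _ => Set.Finite.pi' (fun _ => Set.finite_Icc _ _)) |>.subset (by
      intro x hx i j
      exact hx i (Set.mem_univ _) j (Set.mem_univ _))
  have hch : ∀ γ : SLZ 2, ∃ k : Matrix.SpecialLinearGroup (Fin 2) ℤ,
      Matrix.SpecialLinearGroup.map (n := Fin 2) (Int.castRingHom ℝ) k = (γ : SL 2) :=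
    fun γ => γ.2
  choose k hk using hch
  have hent : ∀ (γ : SLZ 2) (i j : Fin 2), ((γ : SL 2) : Matrix (Fin 2) (Fin 2) ℝ) i j =
      ((k γ : Matrix (Fin 2) (Fin 2) ℤ) i j : ℝ) := by
    intro γ i j
    rw [← hk γ]; simp
  refine Set.Finite.of_finite_image (f := fun γ : SLZ 2 => fun i j =>
    (k γ : Matrix (Fin 2) (Fin 2) ℤ) i j) (hfin.subset ?_) ?_
  · rintro _ ⟨γ, hγ, rfl⟩ i - j -
    have := hγ i j
    rw [hent, abs_le] at this
    constructor
    · have h2 : ((-⌈M⌉ : ℤ) : ℝ) ≤ ((k γ : Matrix (Fin 2) (Fin 2) ℤ) i j : ℝ) := by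
        push_cast; linarith [Int.le_ceil M]
      exact_mod_cast h2
    · have h2 : ((k γ : Matrix (Fin 2) (Fin 2) ℤ) i j : ℝ) ≤ ((⌈M⌉ : ℤ) : ℝ) := by
        linarith [Int.le_ceil M]
      exact_mod_cast h2
  · intro γ _ γ' _ h
    apply Subtype.ext
    apply Matrix.SpecialLinearGroup.ext
    intro i j
    rw [hent, hent]
    have := congrFun (congrFun h i) j
    simpa using this

theorem sl_inv_mul_box {M N : ℝ} (hM : 0 < M) {g h : SL 2} (hg : g ∈ slBox M)
    (hh : g * h ∈ slBox N) : h ∈ slBox (2 * M * N) := by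
  have e : h = g⁻¹ * (g * h) := by group
  have hN : 0 ≤ N := (abs_nonneg _).trans (hh 0 0)
  intro i j
  rw [e]
  generalize g * h = x at hh
  rw [Matrix.SpecialLinearGroup.coe_mul, Matrix.mul_apply, Fin.sum_univ_two]
  have hinv : g⁻¹ ∈ slBox M := by
    intro i j
    rw [Matrix.SpecialLinearGroup.coe_inv, Matrix.adjugate_fin_two]
    fin_cases i <;> fin_cases j <;> simp [abs_neg] <;> exact hg _ _
  refine (abs_add_le _ _).trans ?_
  rw [abs_mul, abs_mul]
  have h1 := mul_le_mul (hinv i 0) (hh 0 j) (abs_nonneg _) hM.le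
  have h2 := mul_le_mul (hinv i 1) (hh 1 j) (abs_nonneg _) hM.le
  linarith

/-! ### Part 2 : Poincare series -/

/-- the Poincare series -/
def poinc (φ : SL 2 → ℝ) (g : SL 2) : ℝ := ∑' γ : SLZ 2, φ (g * γ)

theorem exists_box_of_hcs {φ : SL 2 → ℝ} (h : HasCompactSupport φ) :
    ∃ N, 0 < N ∧ ∀ g, φ g ≠ 0 → g ∈ slBox N := by
  obtain ⟨N, hN, hsub⟩ := compact_subset_slBox h
  exact ⟨N, hN, fun g hg => hsub (subset_tsupport _ hg)⟩

theorem exists_box_nhds (g : SL 2) : ∃ M, 0 < M ∧ slBox M ∈ 𝓝 g := by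
  obtain ⟨K, hK, hg⟩ := exists_compact_mem_nhds g
  obtain ⟨M, hM, hsub⟩ := compact_subset_slBox hK
  exact ⟨M, hM, mem_of_superset hg hsub⟩

theorem exists_finset_box {φ : SL 2 → ℝ} (h : HasCompactSupport φ) {M : ℝ} (hM : 0 < M) :
    ∃ S : Finset (SLZ 2), ∀ g ∈ slBox M, ∀ γ : SLZ 2, γ ∉ S → φ (g * γ) = 0 := by
  obtain ⟨N, hN, hφ⟩ := exists_box_of_hcs h
  refine ⟨(slz_finite (2 * M * N)).toFinset, fun g hg γ hγ => ?_⟩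
  by_contra h'
  apply hγ
  rw [Set.Finite.mem_toFinset]
  exact sl_inv_mul_box hM hg (hφ _ h')

theorem poinc_finite {φ : SL 2 → ℝ} (h : HasCompactSupport φ) (g : SL 2) :
    (Function.support (fun γ : SLZ 2 => φ (g * γ))).Finite := by
  obtain ⟨M, hM, hg⟩ := exists_box_nhds g
  obtain ⟨S, hS⟩ := exists_finset_box h hM
  refine S.finite_toSet.subset (fun γ hγ => ?_)
  by_contra h'
  exact hγ (hS g (mem_of_mem_nhds hg) γ h')

theorem poinc_summable {φ : SL 2 → ℝ} (h : HasCompactSupport φ) (g : SL 2) :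
    Summable (fun γ : SLZ 2 => φ (g * γ)) :=
  summable_of_hasFiniteSupport (poinc_finite h g)

theorem poinc_continuous {φ : SL 2 → ℝ} (hc : Continuous φ) (h : HasCompactSupport φ) :
    Continuous (poinc φ) := by
  rw [continuous_iff_continuousAt]
  intro g
  obtain ⟨M, hM, hg⟩ := exists_box_nhds g
  obtain ⟨S, hS⟩ := exists_finset_box h hM
  have hcont : Continuous (fun g : SL 2 => ∑ γ ∈ S, φ (g * γ)) :=
    continuous_finsetSum _ (fun γ _ => hc.comp (continuous_mul_const _))
  refine hcont.continuousAt.congr ?_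
  filter_upwards [hg] with x hx
  exact (tsum_eq_sum (fun γ hγ => hS x hx γ hγ)).symm

theorem poinc_mul_right (φ : SL 2 → ℝ) (g : SL 2) (l : SLZ 2) :
    poinc φ (g * l) = poinc φ g := by
  unfold poinc
  rw [← (Equiv.mulLeft l).tsum_eq (fun γ : SLZ 2 => φ (g * γ))]
  simp [mul_assoc]

/-- the descended Poincare series -/
def poincX (φ : SL 2 → ℝ) : SL 2 ⧸ SLZ 2 → ℝ :=
  Quotient.lift (poinc φ) (by
    intro a b hab
    have := QuotientGroup.leftRel_apply.1 hab
    have e : b = a * ((⟨a⁻¹ * b, this⟩ : SLZ 2) : SL 2) := by simp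
    rw [e, poinc_mul_right])

@[simp] theorem poincX_mk (φ : SL 2 → ℝ) (g : SL 2) :
    poincX φ (g : SL 2 ⧸ SLZ 2) = poinc φ g := rfl

theorem poincX_continuous {φ : SL 2 → ℝ} (hc : Continuous φ) (h : HasCompactSupport φ) :
    Continuous (poincX φ) :=
  (poinc_continuous hc h).quotient_lift _

theorem poinc_eq_zero {φ : SL 2 → ℝ} {g : SL 2} (h : poinc φ g ≠ 0) :
    ∃ γ : SLZ 2, φ (g * γ) ≠ 0 := by
  by_contra! h'
  apply h
  simp [poinc, h']

theorem poincX_bounded {φ : SL 2 → ℝ} (hc : Continuous φ) (h : HasCompactSupport φ) :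
    ∃ C, ∀ x, ‖poincX φ x‖ ≤ C := by
  obtain ⟨N, hN, hφ⟩ := exists_box_of_hcs h
  obtain ⟨C, hC⟩ := (slBox_compact N).exists_bound_of_continuousOn
    (poinc_continuous hc h).continuousOn
  refine ⟨max C 0, fun x => ?_⟩
  induction x using QuotientGroup.induction_on with
  | H g =>
    by_cases h0 : poinc φ g = 0
    · simp [h0]
    · obtain ⟨γ, hγ⟩ := poinc_eq_zero h0
      have := hC _ (hφ _ hγ)
      rw [poinc_mul_right] at this
      exact this.trans (le_max_left _ _)

/-- as a bounded continuous function -/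
def poincB (φ : SL 2 → ℝ) (hc : Continuous φ) (h : HasCompactSupport φ) :
    BoundedContinuousFunction (SL 2 ⧸ SLZ 2) ℝ :=
  BoundedContinuousFunction.ofNormedAddCommGroup (poincX φ) (poincX_continuous hc h)
    (poincX_bounded hc h).choose (poincX_bounded hc h).choose_spec

theorem poincX_integrable {φ : SL 2 → ℝ} (hc : Continuous φ) (h : HasCompactSupport φ)
    (m : Measure (SL 2 ⧸ SLZ 2)) [IsProbabilityMeasure m] : Integrable (poincX φ) m := by
  obtain ⟨C, hC⟩ := poincX_bounded hc h
  exact Integrable.of_bound (poincX_continuous hc h).measurable.aestronglyMeasurable C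
    (Eventually.of_forall hC)

theorem poincX_nonneg {φ : SL 2 → ℝ} (h : ∀ g, 0 ≤ φ g) (x : SL 2 ⧸ SLZ 2) : 0 ≤ poincX φ x := by
  induction x using QuotientGroup.induction_on with
  | H g => exact tsum_nonneg (fun γ => h _)

/-- the positive functional -/
def poincFun (m : Measure (SL 2 ⧸ SLZ 2)) [IsProbabilityMeasure m] :
    CompactlySupportedContinuousMap (SL 2) ℝ →ₚ[ℝ] ℝ :=
  PositiveLinearMap.mk₀
    { toFun := fun φ => ∫ x, poincX φ x ∂m
      map_add' := by
        intro φ ψ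
        rw [← integral_add (poincX_integrable (map_continuous φ) φ.hasCompactSupport m)
          (poincX_integrable (map_continuous ψ) ψ.hasCompactSupport m)]
        congr 1
        ext x
        induction x using QuotientGroup.induction_on with
        | H g =>
          simp only [poincX_mk, poinc]
          rw [← (poinc_summable φ.hasCompactSupport g).tsum_add
            (poinc_summable ψ.hasCompactSupport g)]
          simp
      map_smul' := by
        intro c φ
        simp only [RingHom.id_apply, smul_eq_mul]
        rw [← integral_const_mul]
        congr 1
        ext x
        induction x using QuotientGroup.induction_on with
        | H g =>
          simp only [poincX_mk, poinc]
          rw [← tsum_mul_left]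
          simp }
    (by
      intro φ hφ
      exact integral_nonneg (fun x => poincX_nonneg (fun g => hφ g) x))

theorem poincFun_apply (m : Measure (SL 2 ⧸ SLZ 2)) [IsProbabilityMeasure m]
    (φ : CompactlySupportedContinuousMap (SL 2) ℝ) :
    poincFun m φ = ∫ x, poincX φ x ∂m := rfl

/-- unfolded measure -/
def unfoldM (m : Measure (SL 2 ⧸ SLZ 2)) [IsProbabilityMeasure m] : Measure (SL 2) :=
  RealRMK.rieszMeasure (poincFun m)

instance (m : Measure (SL 2 ⧸ SLZ 2)) [IsProbabilityMeasure m] : (unfoldM m).Regular := by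
  unfold unfoldM; infer_instance

theorem integral_unfoldM (m : Measure (SL 2 ⧸ SLZ 2)) [IsProbabilityMeasure m]
    {φ : SL 2 → ℝ} (hc : Continuous φ) (h : HasCompactSupport φ) :
    ∫ g, φ g ∂(unfoldM m) = ∫ x, poincX φ x ∂m :=
  RealRMK.integral_rieszMeasure (poincFun m) ⟨⟨φ, hc⟩, h⟩

theorem hcs_mul_left {φ : SL 2 → ℝ} (h : HasCompactSupport φ) (k : SL 2) :
    HasCompactSupport (fun g => φ (k * g)) :=
  h.comp_homeomorph (Homeomorph.mulLeft k)

theorem measurable_smulX (k : SL 2) : Measurable (fun x : SL 2 ⧸ SLZ 2 => k • x) := by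
  apply Continuous.measurable
  exact continuous_const_smul k

theorem unfoldM_inv (m : Measure (SL 2 ⧸ SLZ 2)) [IsProbabilityMeasure m]
    (hminv : ∀ g : SL 2, Measure.map (fun x => g • x) m = m) :
    (unfoldM m).IsMulLeftInvariant := by
  constructor
  intro k
  have : (Measure.map (fun g => k * g) (unfoldM m)).Regular :=
    Measure.Regular.map (Homeomorph.mulLeft k)
  apply Measure.ext_of_integral_eq_on_compactlySupported
  intro φ
  rw [integral_map (continuous_const_mul k).measurable.aemeasurable
    (map_continuous φ).measurable.aestronglyMeasurable,
    integral_unfoldM m (map_continuous φ) φ.hasCompactSupport,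
    integral_unfoldM m (φ := fun g => φ (k * g)) ((map_continuous φ).comp (continuous_const_mul k))
      (hcs_mul_left φ.hasCompactSupport k)]
  conv_rhs => rw [← hminv k]
  rw [integral_map (measurable_smulX k).aemeasurable
    (poincX_continuous (map_continuous φ) φ.hasCompactSupport).measurable.aestronglyMeasurable]
  congr 1
  ext x
  induction x using QuotientGroup.induction_on with
  | H g =>
    change poinc (fun g => φ (k * g)) g = poincX φ ((k * g : SL 2) : SL 2 ⧸ SLZ 2)
    rw [poincX_mk]
    simp [poinc, mul_assoc]

/-- a cutoff function -/
theorem unfoldM_ne_zero (m : Measure (SL 2 ⧸ SLZ 2)) [IsProbabilityMeasure m] :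
    unfoldM m ≠ 0 := by
  intro h0
  have key : ∀ n : ℕ, m ((fun g : SL 2 => (g : SL 2 ⧸ SLZ 2)) '' slBox n) = 0 := by
    intro n
    obtain ⟨φ, h1, -, hcs, h01⟩ := exists_continuous_one_zero_of_isCompact (slBox_compact n)
      isClosed_empty (by simp)
    have hI := integral_unfoldM m φ.continuous hcs
    rw [h0, integral_zero_measure] at hI
    have hnn : ∀ x, 0 ≤ poincX φ x := poincX_nonneg (fun g => (h01 g).1)
    have := (integral_eq_zero_iff_of_nonneg hnn (poincX_integrable φ.continuous hcs m)).1 hI.symm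
    rw [Filter.EventuallyEq, ae_iff] at this
    refine measure_mono_null ?_ this
    rintro _ ⟨g, hg, rfl⟩
    have hle : φ g ≤ poinc φ g := by
      have := (poinc_summable hcs g).le_tsum 1 (fun γ _ => (h01 (g * γ)).1)
      simpa [poinc] using this
    have h1g : φ g = 1 := h1 hg
    have : (0 : ℝ) < poinc φ g := by linarith
    exact this.ne'
  have hun : m Set.univ = 0 := by
    have : (Set.univ : Set (SL 2 ⧸ SLZ 2)) ⊆
        ⋃ n : ℕ, (fun g : SL 2 => (g : SL 2 ⧸ SLZ 2)) '' slBox n := by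
      intro x _
      induction x using QuotientGroup.induction_on with
      | H g =>
        obtain ⟨M, hM, hg⟩ := exists_box_nhds g
        obtain ⟨n, hn⟩ := exists_nat_ge M
        refine Set.mem_iUnion.2 ⟨n, g, fun i j => (mem_of_mem_nhds hg i j).trans hn, rfl⟩
    exact measure_mono_null this (measure_iUnion_null key)
  simp at hun

/-! ### Part 3 : an explicit left invariant measure -/

/-- squared norm of the second column -/
def nsq (w : Fin 2 → ℝ) : ℝ := w 0 ^ 2 + w 1 ^ 2

theorem nsq_pos {w : Fin 2 → ℝ} (h : w ≠ 0) : 0 < nsq w := by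
  by_contra h'
  apply h
  have h0 : nsq w = 0 := le_antisymm (not_lt.1 h') (by unfold nsq; positivity)
  unfold nsq at h0
  have h1 : w 0 = 0 := by nlinarith [sq_nonneg (w 0), sq_nonneg (w 1)]
  have h2 : w 1 = 0 := by nlinarith [sq_nonneg (w 0), sq_nonneg (w 1)]
  ext i; fin_cases i <;> simp [h1, h2]

/-- matrix constructor -/
def slMk (a b c d : ℝ) (h : a * d - b * c = 1) : SL 2 :=
  ⟨!![a, b; c, d], by rw [Matrix.det_fin_two_of]; exact h⟩

theorem slMk_coe (a b c d : ℝ) (h : a * d - b * c = 1) :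
    (slMk a b c d h : Matrix (Fin 2) (Fin 2) ℝ) = !![a, b; c, d] := rfl

instance : MeasurableSpace (Matrix (Fin 2) (Fin 2) ℝ) :=
  inferInstanceAs (MeasurableSpace (Fin 2 → Fin 2 → ℝ))
instance : BorelSpace (Matrix (Fin 2) (Fin 2) ℝ) :=
  inferInstanceAs (BorelSpace (Fin 2 → Fin 2 → ℝ))

open Classical in
/-- the chart -/
def chart (q : (Fin 2 → ℝ) × ℝ) : SL 2 :=
  if h : q.1 ≠ 0 then
    slMk (q.1 1 / nsq q.1 + q.2 * q.1 0) (q.1 0) (- q.1 0 / nsq q.1 + q.2 * q.1 1) (q.1 1) (by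
      have := (nsq_pos h).ne'
      field_simp
      unfold nsq
      ring)
  else 1

theorem chart_coe {q : (Fin 2 → ℝ) × ℝ} (h : q.1 ≠ 0) :
    (chart q : Matrix (Fin 2) (Fin 2) ℝ) =
    !![q.1 1 / nsq q.1 + q.2 * q.1 0, q.1 0; - q.1 0 / nsq q.1 + q.2 * q.1 1, q.1 1] := by
  unfold chart
  rw [dif_pos h, slMk_coe]

theorem measurable_chart : Measurable chart := by
  rw [← sl_isClosedEmbedding.measurableEmbedding.measurable_comp_iff]
  have h0 : MeasurableSet {q : (Fin 2 → ℝ) × ℝ | q.1 ≠ 0} :=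
    (isOpen_ne.preimage continuous_fst).measurableSet
  have e : ((fun g : SL 2 => (g : Matrix (Fin 2) (Fin 2) ℝ)) ∘ chart) = fun q =>
      open Classical in if q.1 ≠ 0 then 
    !![q.1 1 / nsq q.1 + q.2 * q.1 0, q.1 0; - q.1 0 / nsq q.1 + q.2 * q.1 1, q.1 1] else 1 := by
    ext1 q
    by_cases h : q.1 ≠ 0
    · simp only [Function.comp, if_pos h, chart_coe h]
    · simp only [Function.comp, if_neg h, chart, dif_neg h]
      rfl
  rw [e]
  refine Measurable.ite h0 ?_ measurable_const
  refine measurable_pi_iff.2 (fun i => measurable_pi_iff.2 (fun j => ?_))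
  unfold nsq
  fin_cases i <;> fin_cases j <;> simp <;> fun_prop

/-- the explicit measure -/
def expM : Measure (SL 2) := Measure.map chart (volume.prod volume)

theorem ae_ne_zero : ∀ᵐ q : (Fin 2 → ℝ) × ℝ ∂(volume.prod volume), q.1 ≠ 0 := by
  have h : ∀ᵐ w : Fin 2 → ℝ, w ≠ 0 := by
    rw [ae_iff]; simp
  exact Measure.quasiMeasurePreserving_fst.ae h

/-- the c-coordinate shift -/
def shC (A : Matrix (Fin 2) (Fin 2) ℝ) (w : Fin 2 → ℝ) : ℝ :=
  ((A *ᵥ ![w 1 / nsq w, - w 0 / nsq w]) 0 * (A *ᵥ w) 0 +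
    (A *ᵥ ![w 1 / nsq w, - w 0 / nsq w]) 1 * (A *ᵥ w) 1) / nsq (A *ᵥ w)

theorem mulVec_ne_zero (k : SL 2) {w : Fin 2 → ℝ} (h : w ≠ 0) :
    (k : Matrix (Fin 2) (Fin 2) ℝ) *ᵥ w ≠ 0 := by
  intro h0
  apply h
  have : (k⁻¹ : SL 2).1 *ᵥ (k.1 *ᵥ w) = w := by
    rw [Matrix.mulVec_mulVec, ← Matrix.SpecialLinearGroup.coe_mul, inv_mul_cancel,
      Matrix.SpecialLinearGroup.coe_one, Matrix.one_mulVec]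
  rw [← this]
  change (k⁻¹ : SL 2).1 *ᵥ ((k : Matrix (Fin 2) (Fin 2) ℝ) *ᵥ w) = 0
  rw [h0, Matrix.mulVec_zero]

theorem mul_chart (k : SL 2) {q : (Fin 2 → ℝ) × ℝ} (h : q.1 ≠ 0) :
    k * chart q = chart ((k : Matrix (Fin 2) (Fin 2) ℝ) *ᵥ q.1, shC k q.1 + q.2) := by
  obtain ⟨w, c⟩ := q
  simp only at h
  have hk : (k : Matrix (Fin 2) (Fin 2) ℝ).det = 1 := k.2
  rw [Matrix.det_fin_two] at hk
  have hn := (nsq_pos h).ne'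
  have hn' := (nsq_pos (mulVec_ne_zero k h)).ne'
  apply Matrix.SpecialLinearGroup.ext
  intro i j
  rw [chart_coe (mulVec_ne_zero k h), Matrix.SpecialLinearGroup.coe_mul, chart_coe h]
  generalize (k : Matrix (Fin 2) (Fin 2) ℝ) = A at *
  have e0 : ∀ v : Fin 2 → ℝ, (A *ᵥ v) 0 = A 0 0 * v 0 + A 0 1 * v 1 := by
    intro v; simp [Matrix.mulVec, dotProduct, Fin.sum_univ_two]
  have e1 : ∀ v : Fin 2 → ℝ, (A *ᵥ v) 1 = A 1 0 * v 0 + A 1 1 * v 1 := by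
    intro v; simp [Matrix.mulVec, dotProduct, Fin.sum_univ_two]
  have hU : (A 0 0 * (w 1 / nsq w) + A 0 1 * (- w 0 / nsq w)) * (A *ᵥ w) 1 -
      (A 1 0 * (w 1 / nsq w) + A 1 1 * (- w 0 / nsq w)) * (A *ᵥ w) 0 = 1 := by
    rw [e0, e1]
    field_simp
    unfold nsq
    linear_combination (w 0 ^ 2 + w 1 ^ 2) * hk
  have hS : shC A w = ((A 0 0 * (w 1 / nsq w) + A 0 1 * (- w 0 / nsq w)) * (A *ᵥ w) 0 +
      (A 1 0 * (w 1 / nsq w) + A 1 1 * (- w 0 / nsq w)) * (A *ᵥ w) 1) / nsq (A *ᵥ w) := by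
    unfold shC
    simp only [e0, e1]
    simp
  have hN : nsq (A *ᵥ w) = (A *ᵥ w) 0 ^ 2 + (A *ᵥ w) 1 ^ 2 := rfl
  have c0 := e0 w
  have c1 := e1 w
  generalize nsq (A *ᵥ w) = N at *
  generalize (A *ᵥ w) 0 = X at *
  generalize (A *ᵥ w) 1 = Y at *
  have r0 : A 0 0 * (w 1 / nsq w) + A 0 1 * (- w 0 / nsq w) = Y / N + shC A w * X := by
    rw [hS]
    generalize A 0 0 * (w 1 / nsq w) + A 0 1 * (- w 0 / nsq w) = U at *
    generalize A 1 0 * (w 1 / nsq w) + A 1 1 * (- w 0 / nsq w) = V at *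
    field_simp
    rw [hN]
    linear_combination Y * hU
  have r1 : A 1 0 * (w 1 / nsq w) + A 1 1 * (- w 0 / nsq w) = -X / N + shC A w * Y := by
    rw [hS]
    generalize A 0 0 * (w 1 / nsq w) + A 0 1 * (- w 0 / nsq w) = U at *
    generalize A 1 0 * (w 1 / nsq w) + A 1 1 * (- w 0 / nsq w) = V at *
    field_simp
    rw [hN]
    linear_combination (-X) * hU
  fin_cases i <;> fin_cases j <;> simp [Matrix.mul_apply, Fin.sum_univ_two]
  · rw [c0, c1] at r0
    linear_combination r0
  · rw [c0, c1] at r1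
    linear_combination r1

theorem measurable_shC (k : SL 2) : Measurable (shC k) := by
  unfold shC nsq
  simp only [Matrix.mulVec, dotProduct, Fin.sum_univ_two]
  simp
  fun_prop

theorem mp_lin (k : SL 2) : MeasurePreserving
    (fun w : Fin 2 → ℝ => (k : Matrix (Fin 2) (Fin 2) ℝ) *ᵥ w) volume volume := by
  refine ⟨by fun_prop, ?_⟩
  have := Real.map_matrix_volume_pi_eq_smul_volume_pi (M := (k : Matrix (Fin 2) (Fin 2) ℝ))
    (by simp)
  rw [Matrix.SpecialLinearGroup.det_coe] at this
  simp only [inv_one, abs_one, ENNReal.ofReal_one, one_smul] at this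
  exact this

instance expM_inv : expM.IsMulLeftInvariant := by
  constructor
  intro k
  have mp := MeasurePreserving.skew_product (mp_lin k) (μc := (volume : Measure ℝ)) (μd := volume)
    (g := fun w c => shC k w + c)
    (((measurable_shC k).comp measurable_fst).add measurable_snd)
    (Eventually.of_forall fun w => map_add_left_eq_self volume _)
  unfold expM
  rw [Measure.map_map (continuous_const_mul k).measurable measurable_chart]
  conv_rhs => rw [← mp.map_eq]
  rw [Measure.map_map measurable_chart mp.measurable]
  apply Measure.map_congr
  filter_upwards [ae_ne_zero] with q hq
  exact mul_chart k hq

instance expM_fin : IsFiniteMeasureOnCompacts expM := by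
  constructor
  intro K hK
  obtain ⟨M, hM, hsub⟩ := compact_subset_slBox hK
  refine (measure_mono hsub).trans_lt ?_
  unfold expM
  rw [Measure.map_apply measurable_chart (slBox_compact M).measurableSet]
  have hb : IsCompact ((Set.pi Set.univ (fun _ : Fin 2 => Set.Icc (-M) M)) ×ˢ
    Set.Icc (-(1 + 4*M^4)) (1 + 4*M^4)) := (isCompact_univ_pi (fun _ => isCompact_Icc)).prod isCompact_Icc
  refine lt_of_le_of_lt (measure_mono_ae ?_) (hb.measure_lt_top (μ := volume.prod volume))
  filter_upwards [ae_ne_zero] with q hq hmem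
  obtain ⟨w, c⟩ := q
  simp only at hq
  have hmem : chart (w, c) ∈ slBox M := hmem
  have hdet := (chart (w, c)).2
  have hn := nsq_pos hq
  have h00 := hmem 0 0
  have h01 := hmem 0 1
  have h10 := hmem 1 0
  have h11 := hmem 1 1
  have hc : c * nsq w = (chart (w, c) : Matrix (Fin 2) (Fin 2) ℝ) 0 0 * w 0 +
      (chart (w, c) : Matrix (Fin 2) (Fin 2) ℝ) 1 0 * w 1 := by
    rw [chart_coe hq]
    simp
    field_simp
    unfold nsq; ring
  have hd1 : (chart (w, c) : Matrix (Fin 2) (Fin 2) ℝ) 0 0 * w 1 -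
      w 0 * (chart (w, c) : Matrix (Fin 2) (Fin 2) ℝ) 1 0 = 1 := by
    rw [chart_coe hq]
    simp
    field_simp
    unfold nsq; ring
  have e01 : (chart (w, c) : Matrix (Fin 2) (Fin 2) ℝ) 0 1 = w 0 := by rw [chart_coe hq]; simp
  have e11 : (chart (w, c) : Matrix (Fin 2) (Fin 2) ℝ) 1 1 = w 1 := by rw [chart_coe hq]; simp
  rw [e01] at h01
  rw [e11] at h11
  generalize (chart (w, c) : Matrix (Fin 2) (Fin 2) ℝ) 0 0 = a at *
  generalize (chart (w, c) : Matrix (Fin 2) (Fin 2) ℝ) 1 0 = b at *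
  have hab : a ^ 2 + b ^ 2 ≤ 2 * M ^ 2 := by
    nlinarith [sq_abs a, sq_abs b, abs_nonneg a, abs_nonneg b]
  have hw2 : nsq w ≤ 2 * M ^ 2 := by
    unfold nsq
    nlinarith [sq_abs (w 0), sq_abs (w 1), abs_nonneg (w 0), abs_nonneg (w 1)]
  have hid : (c * nsq w) ^ 2 + 1 = (a ^ 2 + b ^ 2) * nsq w := by
    rw [hc]
    have : (1 : ℝ) = (a * w 1 - w 0 * b) ^ 2 := by rw [hd1]; norm_num
    rw [this]
    unfold nsq; ring
  have h3 : 1 ≤ 2 * M ^ 2 * nsq w := by nlinarith [sq_nonneg (c * nsq w)]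
  have h4 : c ^ 2 * nsq w ≤ 2 * M ^ 2 := by
    have : c ^ 2 * nsq w * nsq w ≤ 2 * M ^ 2 * nsq w := by nlinarith
    exact le_of_mul_le_mul_right this hn
  have h5 : c ^ 2 ≤ 4 * M ^ 4 := by
    have : c ^ 2 * 1 ≤ c ^ 2 * (2 * M ^ 2 * nsq w) := by gcongr
    nlinarith
  refine ⟨?_, ?_⟩
  · intro i _
    fin_cases i
    · exact abs_le.1 h01
    · exact abs_le.1 h11
  · constructor <;> nlinarith

/-! ### Part 4 : test functions -/

/-- bump on `[0,1]` -/
def rho (s : ℝ) : ℝ := max 0 (s * (1 - s))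

/-- bump on `[1,e]` -/
def psi (y : ℝ) : ℝ := rho (Real.log (max y 1))

theorem rho_nonneg (s : ℝ) : 0 ≤ rho s := le_max_left _ _

theorem rho_continuous : Continuous rho := by unfold rho; fun_prop

theorem rho_eq_zero_of_le {s : ℝ} (h : s ≤ 0) : rho s = 0 := by
  unfold rho; rw [max_eq_left]; nlinarith

theorem rho_eq_zero_of_ge {s : ℝ} (h : 1 ≤ s) : rho s = 0 := by
  unfold rho; rw [max_eq_left]; nlinarith

theorem psi_nonneg (y : ℝ) : 0 ≤ psi y := rho_nonneg _

theorem psi_continuous : Continuous psi := by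
  unfold psi
  refine rho_continuous.comp (Continuous.log (by fun_prop) (fun y => ?_))
  have : (1 : ℝ) ≤ max y 1 := le_max_right _ _
  linarith

theorem psi_eq_zero_of_le {y : ℝ} (h : y ≤ 1) : psi y = 0 := by
  unfold psi; rw [max_eq_right h, Real.log_one]; exact rho_eq_zero_of_le le_rfl

theorem psi_eq_zero_of_ge {y : ℝ} (h : Real.exp 1 ≤ y) : psi y = 0 := by
  unfold psi
  have h1 : 1 ≤ y := le_trans (by simp) h
  rw [max_eq_left h1]
  apply rho_eq_zero_of_ge
  rw [Real.le_log_iff_exp_le (by linarith)]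
  exact h

theorem psi_ne_zero {y : ℝ} (h : psi y ≠ 0) : 1 < y ∧ y < Real.exp 1 := by
  constructor
  · by_contra h'; exact h (psi_eq_zero_of_le (not_lt.1 h'))
  · by_contra h'; exact h (psi_eq_zero_of_ge (not_lt.1 h'))

theorem psi_exp (s : ℝ) : psi (Real.exp s) = rho s := by
  unfold psi
  rcases le_total s 0 with h | h
  · rw [max_eq_right (Real.exp_le_one_iff.2 h), Real.log_one, rho_eq_zero_of_le le_rfl,
      rho_eq_zero_of_le h]
  · rw [max_eq_left (Real.one_le_exp h), Real.log_exp]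

/-- test function on the group -/
def tf (Φ : ℝ × ℝ → ℝ) (g : SL 2) : ℝ :=
  psi ((g : Matrix (Fin 2) (Fin 2) ℝ) 1 1) *
    Φ (-((g : Matrix (Fin 2) (Fin 2) ℝ) 0 1 * (g : Matrix (Fin 2) (Fin 2) ℝ) 1 1),
      (g : Matrix (Fin 2) (Fin 2) ℝ) 1 0 / max ((g : Matrix (Fin 2) (Fin 2) ℝ) 1 1) 1)

theorem tf_continuous {Φ : ℝ × ℝ → ℝ} (hΦ : Continuous Φ) : Continuous (tf Φ) := by
  have h01 := sl_continuous_entry 0 1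
  have h10 := sl_continuous_entry 1 0
  have h11 := sl_continuous_entry 1 1
  unfold tf
  refine (psi_continuous.comp h11).mul (hΦ.comp ((h01.mul h11).neg.prodMk
    (h10.div (h11.max continuous_const) (fun g => ?_))))
  have : (1 : ℝ) ≤ max ((g : Matrix (Fin 2) (Fin 2) ℝ) 1 1) 1 := le_max_right _ _
  linarith

theorem tf_compact {Φ : ℝ × ℝ → ℝ} (h : HasCompactSupport Φ) : HasCompactSupport (tf Φ) := by
  obtain ⟨R, hR⟩ := h.isBounded.exists_norm_le
  have hR : ∀ z, Φ z ≠ 0 → |z.1| ≤ R ∧ |z.2| ≤ R := by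
    intro z hz
    have := hR z (subset_tsupport _ hz)
    exact ⟨(norm_fst_le z).trans this, (norm_snd_le z).trans this⟩
  set E := Real.exp 1 with hE
  refine hasCompactSupport_of_box (E + |R| + |R| * E + (1 + |R| * (|R| * E))) (fun g hg => ?_)
  have h1 : psi ((g : Matrix (Fin 2) (Fin 2) ℝ) 1 1) ≠ 0 := left_ne_zero_of_mul hg
  have h2 := hR _ (right_ne_zero_of_mul hg)
  obtain ⟨hy1, hy2⟩ := psi_ne_zero h1
  have hdet : (g : Matrix (Fin 2) (Fin 2) ℝ).det = 1 := g.2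
  rw [Matrix.det_fin_two] at hdet
  simp only [max_eq_left hy1.le] at h2
  obtain ⟨h3, h4⟩ := h2
  have key : ∀ a b c d : ℝ, a * d - b * c = 1 → 1 < d → d < E → |-(b * d)| ≤ R → |c / d| ≤ R →
      |a| ≤ 1 + |R| * (|R| * E) ∧ |b| ≤ |R| ∧ |c| ≤ |R| * E ∧ |d| ≤ E := by
    intro a b c d hdet h1 h2 h3 h4
    have hR0 : 0 ≤ R := (abs_nonneg _).trans h4
    rw [abs_of_nonneg hR0]
    have hd : |d| = d := abs_of_pos (by linarith)
    rw [abs_neg, abs_mul, hd] at h3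
    rw [abs_div, hd, div_le_iff₀ (by linarith)] at h4
    have hb : |b| ≤ R := by nlinarith [abs_nonneg b]
    have hc : |c| ≤ R * E := by nlinarith [abs_nonneg c]
    refine ⟨?_, hb, hc, by rw [hd]; exact h2.le⟩
    have e : a * d = 1 + b * c := by linarith
    have : |a| * d ≤ 1 + |b| * |c| := by
      have e2 : |a| * d = |a * d| := by rw [abs_mul, hd]
      rw [e2, e, ← abs_mul]
      exact (abs_add_le _ _).trans (by simp)
    have h5 : |b| * |c| ≤ R * (R * E) := mul_le_mul hb hc (abs_nonneg _) hR0
    nlinarith [abs_nonneg a]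
  obtain ⟨ka, kb, kc, kd⟩ := key _ _ _ _ hdet hy1 hy2 h3 h4
  have hE0 : 0 < E := Real.exp_pos 1
  have q1 : 0 ≤ |R| := abs_nonneg _
  have q2 : 0 ≤ |R| * E := by positivity
  have q3 : 0 ≤ |R| * (|R| * E) := by positivity
  intro i j
  fin_cases i <;> fin_cases j
  · exact ka.trans (by linarith)
  · exact kb.trans (by linarith)
  · exact kc.trans (by linarith)
  · exact kd.trans (by linarith)

/-- constant -/
def Kpsi : ℝ := ∫ y, psi y * |y⁻¹|

theorem Kpsi_pos : 0 < Kpsi := by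
  have e : ∀ y, psi y * |y⁻¹| = psi y * |(max y 1)⁻¹| := by
    intro y
    rcases le_total y 1 with h | h
    · rw [psi_eq_zero_of_le h]; simp
    · rw [max_eq_left h]
  unfold Kpsi
  simp_rw [e]
  refine Continuous.integral_pos_of_hasCompactSupport_nonneg_nonzero (x := Real.exp (1/2))
    ?_ ?_ ?_ ?_
  · refine psi_continuous.mul (Continuous.abs (Continuous.inv₀ (by fun_prop) (fun y => ?_)))
    have : (1 : ℝ) ≤ max y 1 := le_max_right _ _
    linarith
  · refine HasCompactSupport.intro (isCompact_Icc (a := (1 : ℝ)) (b := Real.exp 1)) (fun y hy => ?_)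
    by_contra h
    have := psi_ne_zero (left_ne_zero_of_mul h)
    exact hy ⟨this.1.le, this.2.le⟩
  · intro y
    exact mul_nonneg (psi_nonneg y) (abs_nonneg _)
  · rw [psi_exp]
    have : rho (1/2) = 1/4 := by unfold rho; norm_num
    rw [this]
    have h1 : (0 : ℝ) < max (Real.exp (1/2)) 1 := lt_max_of_lt_right one_pos
    have := inv_pos.2 h1
    positivity

theorem integral_tf {Φ : ℝ × ℝ → ℝ} (hΦ : Continuous Φ) (hs : HasCompactSupport Φ) :
    ∫ g, tf Φ g ∂expM = Kpsi * ∫ z, Φ z := by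
  have hIntg : Integrable (tf Φ) expM :=
    (tf_continuous hΦ).integrable_of_hasCompactSupport (tf_compact hs)
  have hIntg2 : Integrable (fun q => tf Φ (chart q)) (volume.prod volume) :=
    (integrable_map_measure hIntg.aestronglyMeasurable measurable_chart.aemeasurable).1 hIntg
  have hΦi : Integrable Φ (volume.prod volume) := hΦ.integrable_of_hasCompactSupport hs
  unfold expM
  rw [integral_map measurable_chart.aemeasurable
    (tf_continuous hΦ).measurable.aestronglyMeasurable, integral_prod _ hIntg2]
  have hinner : ∀ w : Fin 2 → ℝ, w ≠ 0 → ∫ c, tf Φ (chart (w, c)) =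
      psi (w 1) * ∫ c, Φ (-(w 0 * w 1), c) := by
    intro w hw
    rcases le_or_gt (w 1) 1 with h | h
    · rw [psi_eq_zero_of_le h, zero_mul]
      have : ∀ c, tf Φ (chart (w, c)) = 0 := by
        intro c
        unfold tf
        rw [chart_coe hw]
        simp [psi_eq_zero_of_le h]
      simp [this]
    · rw [← integral_const_mul]
      rw [← integral_add_right_eq_self (fun c => psi (w 1) * Φ (-(w 0 * w 1), c)) (- w 0 / (nsq w * w 1))]
      congr 1
      ext c
      unfold tf
      rw [chart_coe hw]
      have : (- w 0 / nsq w + c * w 1) / max (w 1) 1 = c + (- w 0 / (nsq w * w 1)) := by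
        rw [max_eq_left h.le]
        have h1 := (nsq_pos hw).ne'
        have h2 : w 1 ≠ 0 := by linarith
        field_simp
        ring
      simp [this]
  have hw0 : ∀ᵐ w : Fin 2 → ℝ, w ≠ 0 := by
    rw [ae_iff]; simp
  have hae : (fun w : Fin 2 → ℝ => ∫ c, tf Φ (chart (w, c))) =ᵐ[volume]
      fun w => psi (w 1) * ∫ c, Φ (-(w 0 * w 1), c) := by
    filter_upwards [hw0] with w hw using hinner w hw
  have hIntg3 : Integrable (fun w : Fin 2 → ℝ => psi (w 1) * ∫ c, Φ (-(w 0 * w 1), c)) volume :=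
    (hIntg2.integral_prod_left).congr hae
  rw [integral_congr_ae hae]
  have mp := (volume_preserving_finTwoArrow ℝ)
  have e1 := mp.integral_comp (MeasurableEquiv.finTwoArrow.measurableEmbedding)
    (fun z : ℝ × ℝ => psi z.2 * ∫ c, Φ (-(z.1 * z.2), c))
  have hIntg4 : Integrable (fun z : ℝ × ℝ => psi z.2 * ∫ c, Φ (-(z.1 * z.2), c))
      (volume.prod volume) := by
    rw [← Measure.volume_eq_prod]
    rw [← mp.integrable_comp_emb (MeasurableEquiv.finTwoArrow.measurableEmbedding)]
    exact hIntg3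
  simp only [MeasurableEquiv.finTwoArrow_apply] at e1
  rw [e1, Measure.volume_eq_prod, integral_prod_symm _ hIntg4, integral_prod _ hΦi]
  simp only
  unfold Kpsi
  rw [← integral_mul_const]
  congr 1
  ext y
  rw [integral_const_mul, mul_assoc]
  congr 1
  have := Measure.integral_comp_mul_left (fun b => ∫ c, Φ (b, c)) (-y)
  simp only [smul_eq_mul, inv_neg, abs_neg] at this
  rw [← this]
  congr 1
  ext x
  simp [mul_comm]

theorem exists_unfold_const (m : Measure (SL 2 ⧸ SLZ 2)) [IsProbabilityMeasure m]
    (hminv : ∀ g : SL 2, Measure.map (fun x => g • x) m = m) :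
    ∃ c0 : ℝ, 0 < c0 ∧ ∀ Φ : ℝ × ℝ → ℝ, Continuous Φ → HasCompactSupport Φ →
      ∫ x, poincX (tf Φ) x ∂m = c0 * ∫ z, Φ z := by
  have hinv := unfoldM_inv m hminv
  -- a reference function
  obtain ⟨φ0, h1, -, hcs, h01⟩ := exists_continuous_one_zero_of_isCompact
    (isCompact_singleton (x := ((0 : ℝ), (0 : ℝ)))) isClosed_empty (by simp)
  have hpos0 : 0 < ∫ z, φ0 z := by
    refine Continuous.integral_pos_of_hasCompactSupport_nonneg_nonzero (x := (0, 0)) φ0.continuous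
      hcs (fun z => (h01 z).1) ?_
    have : φ0 (0, 0) = 1 := h1 rfl
    rw [this]; norm_num
  let ν : Measure (SL 2) := Measure.haar
  have e1 : ∀ Φ : ℝ × ℝ → ℝ, Continuous Φ → HasCompactSupport Φ →
      Kpsi * ∫ z, Φ z = (Measure.haarScalarFactor expM ν : ℝ) * ∫ g, tf Φ g ∂ν := by
    intro Φ h1 h2
    have := Measure.integral_isMulLeftInvariant_eq_smul_of_hasCompactSupport expM ν
      (tf_continuous h1) (tf_compact h2)
    rw [integral_tf h1 h2, integral_smul_nnreal_measure] at this
    exact this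
  have e2 : ∀ Φ : ℝ × ℝ → ℝ, Continuous Φ → HasCompactSupport Φ →
      ∫ x, poincX (tf Φ) x ∂m =
        (Measure.haarScalarFactor (unfoldM m) ν : ℝ) * ∫ g, tf Φ g ∂ν := by
    intro Φ h1 h2
    have := Measure.integral_isMulLeftInvariant_eq_smul_of_hasCompactSupport (unfoldM m) ν
      (tf_continuous h1) (tf_compact h2)
    rw [integral_unfoldM m (tf_continuous h1) (tf_compact h2), integral_smul_nnreal_measure] at this
    exact this
  set k1 := Measure.haarScalarFactor expM ν with hk1
  set k2 := Measure.haarScalarFactor (unfoldM m) ν with hk2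
  have hk1p : 0 < (k1 : ℝ) := by
    have := e1 φ0 φ0.continuous hcs
    have h3 : 0 < Kpsi * ∫ z, φ0 z := mul_pos Kpsi_pos hpos0
    rw [this] at h3
    rcases (NNReal.coe_nonneg k1).lt_or_eq with h | h
    · exact h
    · rw [← h] at h3; simp at h3
  have hk2p : 0 < (k2 : ℝ) := by
    rw [NNReal.coe_pos, pos_iff_ne_zero]
    intro h0
    apply unfoldM_ne_zero m
    have := Measure.isMulLeftInvariant_eq_smul (unfoldM m) ν
    rw [this, ← hk2, h0, zero_smul]
  refine ⟨k2 / k1 * Kpsi, mul_pos (div_pos hk2p hk1p) Kpsi_pos, fun Φ h1 h2 => ?_⟩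
  rw [e2 Φ h1 h2, mul_assoc, e1 Φ h1 h2]
  field_simp

/-! ### Part 5 : continued fractions -/

/-- numerators -/
def cfP (α : ℝ) : ℕ → ℤ
  | 0 => 1
  | 1 => 0
  | (n+2) => cfP α n + ⌊(gaussMap^[n] α)⁻¹⌋ * cfP α (n+1)

/-- denominators -/
def cfQ (α : ℝ) : ℕ → ℤ
  | 0 => 0
  | 1 => 1
  | (n+2) => cfQ α n + ⌊(gaussMap^[n] α)⁻¹⌋ * cfQ α (n+1)

/-- errors -/
def cfD (α : ℝ) (n : ℕ) : ℝ := (-1) ^ n * (cfP α n - α * cfQ α n)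

section CF
variable {α : ℝ}

theorem gx_mem (hα : α ∈ Set.Ioo (0 : ℝ) 1) (hirr : Irrational α) (n : ℕ) :
    gaussMap^[n] α ∈ Set.Ioo (0 : ℝ) 1 ∧ Irrational (gaussMap^[n] α) := by
  induction n with
  | zero => exact ⟨hα, hirr⟩
  | succ n ih =>
    rw [Function.iterate_succ_apply']
    have h1 : Irrational (gaussMap (gaussMap^[n] α)) := by
      unfold gaussMap Int.fract
      have := (irrational_inv_iff.2 ih.2)
      exact this.sub_intCast _
    refine ⟨⟨?_, Int.fract_lt_one _⟩, h1⟩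
    exact lt_of_le_of_ne (Int.fract_nonneg _) h1.ne_zero.symm

theorem cfa_pos (hα : α ∈ Set.Ioo (0 : ℝ) 1) (hirr : Irrational α) (n : ℕ) :
    1 ≤ ⌊(gaussMap^[n] α)⁻¹⌋ := by
  rw [Int.le_floor]
  obtain ⟨⟨h0, h1⟩, -⟩ := gx_mem hα hirr n
  rw [Int.cast_one]
  exact (one_le_inv₀ h0).2 h1.le

theorem cfD_rec (n : ℕ) :
    cfD α (n+2) = cfD α n - ⌊(gaussMap^[n] α)⁻¹⌋ * cfD α (n+1) := by
  unfold cfD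
  rw [cfP, cfQ]
  push_cast
  rw [pow_succ, pow_succ]
  ring

theorem cfD_succ (hα : α ∈ Set.Ioo (0 : ℝ) 1) (hirr : Irrational α) (n : ℕ) :
    cfD α (n+1) = gaussMap^[n] α * cfD α n := by
  induction n with
  | zero => simp [cfD, cfP, cfQ]
  | succ n ih =>
    rw [cfD_rec, Function.iterate_succ_apply', ih]
    have h0 : gaussMap^[n] α ≠ 0 := (gx_mem hα hirr n).2.ne_zero
    generalize gaussMap^[n] α = x at *
    unfold gaussMap Int.fract
    field_simp

theorem cfD_pos (hα : α ∈ Set.Ioo (0 : ℝ) 1) (hirr : Irrational α) (n : ℕ) : 0 < cfD α n := by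
  induction n with
  | zero => simp [cfD, cfP, cfQ]
  | succ n ih =>
    rw [cfD_succ hα hirr]
    exact mul_pos (gx_mem hα hirr n).1.1 ih

theorem cfD_lt (hα : α ∈ Set.Ioo (0 : ℝ) 1) (hirr : Irrational α) (n : ℕ) :
    cfD α (n+1) < cfD α n := by
  rw [cfD_succ hα hirr]
  have := (gx_mem hα hirr n).1.2
  nlinarith [cfD_pos hα hirr n]

theorem cfQ_aux (hα : α ∈ Set.Ioo (0 : ℝ) 1) (hirr : Irrational α) (n : ℕ) :
    0 ≤ cfQ α n ∧ cfQ α n ≤ cfQ α (n+1) ∧ 1 ≤ cfQ α (n+1) := by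
  induction n with
  | zero => simp [cfQ]
  | succ n ih =>
    obtain ⟨h1, h2, h3⟩ := ih
    have ha := cfa_pos hα hirr n
    rw [cfQ]
    refine ⟨by omega, by nlinarith, by nlinarith⟩

theorem cfQ_lt (hα : α ∈ Set.Ioo (0 : ℝ) 1) (hirr : Irrational α) (n : ℕ) :
    cfQ α (n+2) < cfQ α (n+3) := by
  obtain ⟨h1, h2, h3⟩ := cfQ_aux hα hirr n
  obtain ⟨h4, h5, h6⟩ := cfQ_aux hα hirr (n+1)
  have ha := cfa_pos hα hirr (n+1)
  have : cfQ α (n+3) = cfQ α (n+1) + ⌊(gaussMap^[n+1] α)⁻¹⌋ * cfQ α (n+2) := by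
    conv_lhs => rw [cfQ]
  rw [this]
  nlinarith

theorem cfQ_mono (hα : α ∈ Set.Ioo (0 : ℝ) 1) (hirr : Irrational α) : Monotone (cfQ α) :=
  monotone_nat_of_le_succ (fun n => (cfQ_aux hα hirr n).2.1)

theorem cfQ_ge (hα : α ∈ Set.Ioo (0 : ℝ) 1) (hirr : Irrational α) (n : ℕ) :
    (n : ℤ) + 1 ≤ cfQ α (n+2) := by
  induction n with
  | zero => simpa using (cfQ_aux hα hirr 1).2.2
  | succ n ih =>
    have := cfQ_lt hα hirr n
    have e : n + 1 + 2 = n + 3 := rfl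
    rw [e]
    push_cast
    omega

theorem cfQ_index (hα : α ∈ Set.Ioo (0 : ℝ) 1) (hirr : Irrational α) {n N : ℕ} (hN : 2 ≤ N)
    (h : cfQ α (n+1) ≤ cfQ α N) : n < N := by
  by_contra h'
  obtain ⟨k, rfl⟩ := Nat.exists_eq_add_of_le hN
  have h1 := cfQ_lt hα hirr k
  have h2 : cfQ α (k + 3) ≤ cfQ α (n+1) := cfQ_mono hα hirr (by omega)
  have e : 2 + k = k + 2 := by ring
  rw [e] at h
  omega

theorem cf_det (n : ℕ) : cfP α n * cfQ α (n+1) - cfP α (n+1) * cfQ α n = (-1) ^ n := by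
  induction n with
  | zero => simp [cfP, cfQ]
  | succ n ih =>
    rw [cfP, cfQ, pow_succ]
    linear_combination -ih

theorem cf_det_real (n : ℕ) : cfD α n * cfQ α (n+1) + cfD α (n+1) * cfQ α n = 1 := by
  have h := cf_det (α := α) n
  have h' : (cfP α n : ℝ) * cfQ α (n+1) - cfP α (n+1) * cfQ α n = (-1) ^ n := by exact_mod_cast h
  unfold cfD
  have e : ((-1 : ℝ) ^ n) * (-1) ^ n = 1 := by rw [← mul_pow]; simp
  rw [pow_succ]
  linear_combination (-1) ^ n * h' + e

theorem cf_unique (hα : α ∈ Set.Ioo (0 : ℝ) 1) (hirr : Irrational α) (n : ℕ) (k : ℤ)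
    (h1 : 0 < cfD α n - k * cfD α (n+1)) (h2 : cfD α n - k * cfD α (n+1) < cfD α (n+1)) :
    ⌊(gaussMap^[n] α)⁻¹⌋ = k := by
  rw [Int.floor_eq_iff]
  have hx := (gx_mem hα hirr n).1.1
  have hd := cfD_pos hα hirr n
  rw [cfD_succ hα hirr] at h1 h2
  generalize gaussMap^[n] α = x at *
  have e1 : (k : ℝ) * x < 1 := by
    by_contra h'
    nlinarith
  have e2 : 1 < ((k : ℝ) + 1) * x := by
    by_contra h'
    nlinarith
  rw [← one_div]
  exact ⟨((lt_div_iff₀ hx).2 e1).le, (div_lt_iff₀ hx).2 e2⟩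

theorem reduced_is_cf (hα : α ∈ Set.Ioo (0 : ℝ) 1) (hirr : Irrational α) (M : ℕ) :
    ∀ (p1 q1 p2 q2 s : ℤ), (s = 1 ∨ s = -1) → q1 ≤ M → p1 * q2 - p2 * q1 = s → 0 < q1 → q1 < q2 →
      0 < -s * (p2 - α * q2) → -s * (p2 - α * q2) < s * (p1 - α * q1) →
      ∃ n : ℕ, p1 = cfP α n ∧ q1 = cfQ α n ∧ p2 = cfP α (n+1) ∧ q2 = cfQ α (n+1) ∧
        s = (-1) ^ n := by
  induction M with
  | zero => intro p1 q1 p2 q2 s _ h1 _ h2; norm_cast at h1; omega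
  | succ M ih =>
    intro p1 q1 p2 q2 s hs hM hdet hq1 hq12 hd2 hd12
    have hdr : (p1 : ℝ) * q2 - p2 * q1 = s := by exact_mod_cast hdet
    have hss : (s : ℝ) * s = 1 := by rcases hs with rfl | rfl <;> norm_num
    have hdd : s * (p1 - α * q1) * q2 + (-s * (p2 - α * q2)) * q1 = 1 := by
      linear_combination s * hdr + hss
    obtain ⟨hα0, hα1⟩ := hα
    rcases eq_or_lt_of_le (show 1 ≤ q1 from hq1) with h1 | h1
    · subst h1
      have hq2 : (2 : ℝ) ≤ q2 := by exact_mod_cast hq12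
      have hlt : s * (p1 - α * (1 : ℤ)) < (1 / 2 : ℝ) := by
        push_cast at *
        nlinarith
      rcases hs with rfl | rfl
      · push_cast at *
        have hp1 : p1 = 1 := by
          have h1 : (p1 : ℝ) < 2 := by linarith
          have h2 : (0 : ℝ) < p1 := by linarith
          have h1' : p1 < 2 := by exact_mod_cast h1
          have h2' : 0 < p1 := by exact_mod_cast h2
          omega
        subst hp1
        have hp2 : p2 = q2 - 1 := by omega
        subst hp2
        push_cast at *
        have ha0 : ⌊(gaussMap^[0] α)⁻¹⌋ = 1 := by
          apply cf_unique ⟨hα0, hα1⟩ hirr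
          · simp [cfD, cfP, cfQ]; linarith
          · simp [cfD, cfP, cfQ]; linarith
        have hP2 : cfP α 2 = 1 := by rw [cfP, ha0]; simp [cfP]
        have hQ2 : cfQ α 2 = 1 := by rw [cfQ, ha0]; simp [cfQ]
        have ha1 : ⌊(gaussMap^[1] α)⁻¹⌋ = q2 - 1 := by
          have eD1 : cfD α 1 = α := by simp [cfD, cfP, cfQ]
          have eD2 : cfD α 2 = 1 - α := by unfold cfD; rw [hP2, hQ2]; norm_num
          apply cf_unique ⟨hα0, hα1⟩ hirr
          · rw [eD1, eD2]; push_cast; linarith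
          · rw [eD1, eD2]; push_cast; linarith
        refine ⟨2, hP2.symm, hQ2.symm, ?_, ?_, by norm_num⟩
        · rw [cfP, ha1, hP2]; simp [cfP]
        · rw [cfQ, ha1, hQ2]; simp [cfQ]
      · push_cast at *
        have hp1 : p1 = 0 := by
          have h1 : (p1 : ℝ) < 1 := by linarith
          have h2 : (-1 : ℝ) < p1 := by linarith
          have h1' : p1 < 1 := by exact_mod_cast h1
          have h2' : -1 < p1 := by exact_mod_cast h2
          omega
        subst hp1
        have hp2 : p2 = 1 := by omega
        subst hp2
        push_cast at *
        have ha0 : ⌊(gaussMap^[0] α)⁻¹⌋ = q2 := by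
          apply cf_unique ⟨hα0, hα1⟩ hirr
          · simp [cfD, cfP, cfQ]; linarith
          · simp [cfD, cfP, cfQ]; linarith
        refine ⟨1, rfl, rfl, ?_, ?_, by norm_num⟩
        · rw [cfP, ha0]; simp [cfP]
        · rw [cfQ, ha0]; simp [cfQ]
    · have hk1 : 1 ≤ q2 / q1 := by
        rw [Int.le_ediv_iff_mul_le hq1]; omega
      have hmod : q2 - q2 / q1 * q1 = q2 % q1 := by
        have := Int.emod_add_mul_ediv q2 q1
        linarith
      have hmod0 : 0 ≤ q2 % q1 := Int.emod_nonneg _ (by omega)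
      have hmod1 : q2 % q1 < q1 := Int.emod_lt_of_pos _ hq1
      generalize hk : q2 / q1 = k at *
      have hne : q2 % q1 ≠ 0 := by
        intro h0
        rw [h0] at hmod
        have hdvd : q1 ∣ 1 := by
          have e : q1 * (s * (p1 * k - p2)) = 1 := by
            have hssi : s * s = 1 := by rcases hs with rfl | rfl <;> norm_num
            linear_combination s * hdet + hssi - s * p1 * hmod
          exact ⟨_, e.symm⟩
        have := Int.le_of_dvd one_pos hdvd
        omega
      have hkr : (1 : ℝ) ≤ k := by exact_mod_cast hk1
      obtain ⟨n, i1, i2, i3, i4, i5⟩ := ih (p2 - k * p1) (q2 - k * q1) p1 q1 (-s)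
        (by rcases hs with rfl | rfl <;> simp) (by push_cast at hM; omega)
        (by linear_combination -hdet) (by omega) (by omega)
        (by push_cast; linarith) (by push_cast; nlinarith)
      have eP : (cfP α n : ℝ) = p2 - k * p1 := by rw [← i1]; push_cast; ring
      have eQ : (cfQ α n : ℝ) = q2 - k * q1 := by rw [← i2]; push_cast; ring
      have esr : ((-1 : ℝ)) ^ n = -s := by
        have : ((-s : ℤ) : ℝ) = ((-1) ^ n : ℤ) := by rw [i5]
        push_cast at this; linarith
      have eD1 : cfD α (n+1) = s * (p1 - α * q1) := by
        unfold cfD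
        rw [pow_succ, esr, ← i3, ← i4]; ring
      have eD0 : cfD α n = -s * (p2 - α * q2) + k * (s * (p1 - α * q1)) := by
        unfold cfD
        rw [esr, eP, eQ]; ring
      have ha : ⌊(gaussMap^[n] α)⁻¹⌋ = k := by
        apply cf_unique ⟨hα0, hα1⟩ hirr
        · rw [eD0, eD1]; linarith
        · rw [eD0, eD1]; linarith
      refine ⟨n + 1, i3, i4, ?_, ?_, ?_⟩
      · rw [cfP, ha, ← i1, ← i3]; ring
      · rw [cfQ, ha, ← i2, ← i4]; ring
      · rw [pow_succ, ← i5]; ring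


end CF

/-! ### Part 6 : the flow and the sandwich -/

/-- total mass of the bump -/
def rhoK : ℝ := ∫ s in (0 : ℝ)..1, rho s

/-- primitive of the bump -/
def rhoG (x : ℝ) : ℝ := ∫ s in (0 : ℝ)..x, rho s

theorem rho_ii (a b : ℝ) : IntervalIntegrable rho volume a b := rho_continuous.intervalIntegrable a b

theorem rhoG_of_le {x : ℝ} (h : x ≤ 0) : rhoG x = 0 := by
  unfold rhoG
  rw [intervalIntegral.integral_symm]
  have : ∫ s in x..0, rho s = ∫ s in x..0, (0 : ℝ) := by
    apply intervalIntegral.integral_congr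
    intro s hs
    rw [Set.uIcc_of_le h] at hs
    exact rho_eq_zero_of_le hs.2
  rw [this]; simp

theorem rhoG_of_ge {x : ℝ} (h : 1 ≤ x) : rhoG x = rhoK := by
  unfold rhoG rhoK
  rw [← intervalIntegral.integral_add_adjacent_intervals (rho_ii 0 1) (rho_ii 1 x)]
  have : ∫ s in (1 : ℝ)..x, rho s = ∫ s in (1 : ℝ)..x, (0 : ℝ) := by
    apply intervalIntegral.integral_congr
    intro s hs
    rw [Set.uIcc_of_le h] at hs
    exact rho_eq_zero_of_ge hs.1
  rw [this]; simp

theorem rhoG_mono : Monotone rhoG := by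
  intro a b h
  unfold rhoG
  rw [← intervalIntegral.integral_add_adjacent_intervals (rho_ii 0 a) (rho_ii a b)]
  have := intervalIntegral.integral_nonneg_of_forall (f := rho) (μ := volume) h rho_nonneg
  linarith

theorem rhoG_nonneg (x : ℝ) : 0 ≤ rhoG x := by
  rcases le_total x 0 with h | h
  · rw [rhoG_of_le h]
  · rw [← rhoG_of_le le_rfl]; exact rhoG_mono h

theorem rhoG_le (x : ℝ) : rhoG x ≤ rhoK := by
  rcases le_total x 1 with h | h
  · rw [← rhoG_of_ge le_rfl]; exact rhoG_mono h
  · rw [rhoG_of_ge h]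

theorem rhoK_pos : 0 < rhoK := by
  unfold rhoK
  apply intervalIntegral.intervalIntegral_pos_of_pos_on (rho_ii 0 1) _ one_pos
  intro x hx
  unfold rho
  exact lt_max_of_lt_right (mul_pos hx.1 (by linarith [hx.2]))

/-- time weight -/
def wt (T y : ℝ) : ℝ := ∫ t in (0 : ℝ)..T, psi (Real.exp (-t) * y)

theorem wt_nonpos {T y : ℝ} (hy : y ≤ 0) : wt T y = 0 := by
  unfold wt
  have : ∀ t, psi (Real.exp (-t) * y) = 0 := fun t => psi_eq_zero_of_le
    (by nlinarith [Real.exp_pos (-t)])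
  simp [this]

theorem wt_eq {T y : ℝ} (hy : 0 < y) : wt T y = rhoG (Real.log y) - rhoG (Real.log y - T) := by
  unfold wt
  have : ∀ t, psi (Real.exp (-t) * y) = rho (Real.log y - t) := by
    intro t
    rw [← psi_exp, Real.exp_sub, Real.exp_log hy, Real.exp_neg]
    congr 1; field_simp
  simp only [this]
  rw [intervalIntegral.integral_comp_sub_left (fun s => rho s)]
  unfold rhoG
  rw [intervalIntegral.integral_interval_sub_left (rho_ii _ _) (rho_ii _ _)]
  simp

theorem wt_nonneg {T : ℝ} (hT : 0 ≤ T) (y : ℝ) : 0 ≤ wt T y :=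
  intervalIntegral.integral_nonneg_of_forall hT (fun _ => psi_nonneg _)

theorem wt_le {T : ℝ} (y : ℝ) : wt T y ≤ rhoK := by
  rcases le_or_gt y 0 with h | h
  · rw [wt_nonpos h]; exact rhoK_pos.le
  · rw [wt_eq h]
    linarith [rhoG_le (Real.log y), rhoG_nonneg (Real.log y - T)]

theorem wt_full {T y : ℝ} (hy : 0 < y) (h1 : 1 ≤ Real.log y) (h2 : Real.log y ≤ T) :
    wt T y = rhoK := by
  rw [wt_eq hy, rhoG_of_ge h1, rhoG_of_le (by linarith), sub_zero]

theorem wt_far {T y : ℝ} (hT : 0 ≤ T) (hy : 0 < y) (h : T + 1 ≤ Real.log y) : wt T y = 0 := by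
  rw [wt_eq hy, rhoG_of_ge (by linarith), rhoG_of_ge (by linarith), sub_self]

section Flow

variable {α : ℝ}

/-- parameters attached to an integral matrix -/
def zz (α : ℝ) (γ : SLZ 2) : ℝ × ℝ :=
  (-(((γ : SL 2) : Matrix (Fin 2) (Fin 2) ℝ) 0 1 - α * ((γ : SL 2) : Matrix (Fin 2) (Fin 2) ℝ) 1 1)
      * ((γ : SL 2) : Matrix (Fin 2) (Fin 2) ℝ) 1 1,
    ((γ : SL 2) : Matrix (Fin 2) (Fin 2) ℝ) 1 0 / ((γ : SL 2) : Matrix (Fin 2) (Fin 2) ℝ) 1 1)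

/-- lower right entry -/
def qq (γ : SLZ 2) : ℝ := ((γ : SL 2) : Matrix (Fin 2) (Fin 2) ℝ) 1 1

theorem tf_flow {a : ℝ → SL 2}
    (ha : ∀ t, (a t : Matrix (Fin 2) (Fin 2) ℝ) = !![Real.exp t, 0; 0, Real.exp (-t)])
    {u : SL 2} (hu : (u : Matrix (Fin 2) (Fin 2) ℝ) = !![1, -α; 0, 1])
    (Φ : ℝ × ℝ → ℝ) (t : ℝ) (γ : SLZ 2) :
    tf Φ (a t * u * γ) = psi (Real.exp (-t) * qq γ) * Φ (zz α γ) := by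
  have key : ∀ i j, ((a t * u * γ : SL 2) : Matrix (Fin 2) (Fin 2) ℝ) i j =
      (!![Real.exp t, 0; 0, Real.exp (-t)] * !![1, -α; 0, 1] *
        ((γ : SL 2) : Matrix (Fin 2) (Fin 2) ℝ)) i j := by
    intro i j
    rw [Matrix.SpecialLinearGroup.coe_mul, Matrix.SpecialLinearGroup.coe_mul, ha, hu]
  unfold tf zz qq
  simp only [key]
  generalize ((γ : SL 2) : Matrix (Fin 2) (Fin 2) ℝ) = M
  simp only [Matrix.mul_apply, Fin.sum_univ_two, Matrix.of_apply, Matrix.cons_val', Matrix.cons_val_zero,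
    Matrix.cons_val_one, Matrix.cons_val_fin_one]
  have e1 : (Real.exp (-t) * 0 + 0) = 0 := by simp
  have e : ∀ x y : ℝ, (0 * 1 + Real.exp (-t) * 0) * x + (0 * -α + Real.exp (-t) * 1) * y =
      Real.exp (-t) * y := by intros; ring
  simp only [e]
  by_cases hp : psi (Real.exp (-t) * M 1 1) = 0
  · rw [hp]; simp
  · obtain ⟨h1, h2⟩ := psi_ne_zero hp
    rw [max_eq_left h1.le]
    congr 2
    ext
    · simp only
      have : Real.exp t * Real.exp (-t) = 1 := by rw [← Real.exp_add]; simp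
      linear_combination (-(M 0 1 - α * M 1 1) * M 1 1) * this
    · simp only
      rw [mul_div_mul_left _ _ (Real.exp_pos _).ne']

theorem flow_cont {a : ℝ → SL 2}
    (ha : ∀ t, (a t : Matrix (Fin 2) (Fin 2) ℝ) = !![Real.exp t, 0; 0, Real.exp (-t)])
    (u : SL 2) : Continuous (fun t => a t * u) := by
  refine Continuous.mul ?_ continuous_const
  rw [sl_continuous_iff]
  intro i j
  simp only [ha]
  fin_cases i <;> fin_cases j <;> simp <;> fun_prop

theorem flow_int {a : ℝ → SL 2}
    (ha : ∀ t, (a t : Matrix (Fin 2) (Fin 2) ℝ) = !![Real.exp t, 0; 0, Real.exp (-t)])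
    {u : SL 2} (hu : (u : Matrix (Fin 2) (Fin 2) ℝ) = !![1, -α; 0, 1])
    {Φ : ℝ × ℝ → ℝ} (hc : Continuous Φ) (hs : HasCompactSupport Φ) {T : ℝ} (hT : 0 ≤ T) :
    HasSum (fun γ : SLZ 2 => wt T (qq γ) * Φ (zz α γ))
      (∫ t in (0 : ℝ)..T, poinc (tf Φ) (a t * u)) := by
  obtain ⟨M, hM, hsub⟩ := compact_subset_slBox
    ((isCompact_Icc (a := (0 : ℝ)) (b := T)).image (flow_cont ha u))
  obtain ⟨S, hS⟩ := exists_finset_box (tf_compact hs) hM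
  have h0 : ∀ t ∈ Set.uIcc 0 T, ∀ γ : SLZ 2, γ ∉ S → psi (Real.exp (-t) * qq γ) * Φ (zz α γ) = 0 := by
    intro t ht γ hγ
    rw [Set.uIcc_of_le hT] at ht
    rw [← tf_flow ha hu]
    exact hS _ (hsub ⟨t, ht, rfl⟩) γ hγ
  have h1 : ∀ γ : SLZ 2, wt T (qq γ) * Φ (zz α γ) =
      ∫ t in (0 : ℝ)..T, psi (Real.exp (-t) * qq γ) * Φ (zz α γ) := by
    intro γ
    rw [intervalIntegral.integral_mul_const]; rfl
  have h2 : ∫ t in (0 : ℝ)..T, poinc (tf Φ) (a t * u) =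
      ∑ γ ∈ S, wt T (qq γ) * Φ (zz α γ) := by
    simp only [h1]
    rw [← intervalIntegral.integral_finsetSum]
    · apply intervalIntegral.integral_congr
      intro t ht
      simp only
      unfold poinc
      simp only [tf_flow ha hu]
      exact tsum_eq_sum (fun γ hγ => h0 t ht γ hγ)
    · intro γ _
      apply Continuous.intervalIntegrable
      exact (psi_continuous.comp (by fun_prop)).mul continuous_const
  rw [h2]
  apply hasSum_sum_of_ne_finset_zero
  intro γ hγ
  rw [h1]
  rw [intervalIntegral.integral_congr (g := fun _ => (0 : ℝ)) (fun t ht => h0 t ht γ hγ)]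
  simp

theorem slz_entries (γ : SLZ 2) : ∃ p1 p2 q1 q2 : ℤ, p1 * q2 - p2 * q1 = 1 ∧
    ((γ : SL 2) : Matrix (Fin 2) (Fin 2) ℝ) = !![(p1 : ℝ), (p2 : ℝ); (q1 : ℝ), (q2 : ℝ)] := by
  obtain ⟨k, hk⟩ := γ.2
  refine ⟨k.1 0 0, k.1 0 1, k.1 1 0, k.1 1 1, ?_, ?_⟩
  · have := k.2
    rw [Matrix.det_fin_two] at this
    exact this
  · rw [← hk]
    ext i j
    fin_cases i <;> fin_cases j <;> rfl

/-- integral matrices -/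
def slzMk (p1 p2 q1 q2 : ℤ) (h : p1 * q2 - p2 * q1 = 1) : SLZ 2 :=
  ⟨Matrix.SpecialLinearGroup.map (n := Fin 2) (Int.castRingHom ℝ)
    ⟨!![p1, p2; q1, q2], by rw [Matrix.det_fin_two_of]; exact h⟩, ⟨_, rfl⟩⟩

theorem slzMk_coe (p1 p2 q1 q2 : ℤ) (h : p1 * q2 - p2 * q1 = 1) :
    ((slzMk p1 p2 q1 q2 h : SL 2) : Matrix (Fin 2) (Fin 2) ℝ) =
      !![(p1 : ℝ), (p2 : ℝ); (q1 : ℝ), (q2 : ℝ)] := by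
  ext i j
  fin_cases i <;> fin_cases j <;> rfl

theorem sgn_sq (n : ℕ) : ((-1 : ℤ) ^ n) * (-1) ^ n = 1 := by rw [← mul_pow]; simp

theorem sgn_sq_real (n : ℕ) : ((-1 : ℝ) ^ n) * (-1) ^ n = 1 := by rw [← mul_pow]; simp

/-- convergent matrices -/
def gam (α : ℝ) (n : ℕ) : SLZ 2 :=
  slzMk ((-1) ^ n * cfP α n) (cfP α (n+1)) ((-1) ^ n * cfQ α n) (cfQ α (n+1)) (by
    linear_combination (-1) ^ n * cf_det (α := α) n + sgn_sq n)

theorem qq_gam (n : ℕ) : qq (gam α n) = cfQ α (n+1) := by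
  unfold qq gam; rw [slzMk_coe]; simp

theorem zz_gam (n : ℕ) : zz α (gam α n) =
    ((-1) ^ n * (cfD α (n+1) * cfQ α (n+1)), (-1) ^ n * ((cfQ α n : ℝ) / (cfQ α (n+1) : ℝ))) := by
  unfold zz gam; rw [slzMk_coe]
  ext
  · simp only [Matrix.of_apply, Matrix.cons_val', Matrix.cons_val_zero,
    Matrix.cons_val_one, Matrix.cons_val_fin_one]
    unfold cfD
    rw [pow_succ]
    linear_combination (cfP α (n+1) - α * cfQ α (n+1) : ℝ) * cfQ α (n+1) * sgn_sq_real n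
  · simp only [Matrix.of_apply, Matrix.cons_val', Matrix.cons_val_zero,
    Matrix.cons_val_one, Matrix.cons_val_fin_one]
    push_cast
    ring

/-- the closed region -/
def RR : Set (ℝ × ℝ) := {z | |z.2| ≤ 1 ∧ 0 ≤ z.1 * z.2 ∧ |z.1| * (1 + |z.2|) ≤ 1}

/-- the open region -/
def RO : Set (ℝ × ℝ) := {z | |z.2| < 1 ∧ 0 < z.1 * z.2 ∧ |z.1| * (1 + |z.2|) < 1}

/-- recover the Gauss orbit point -/
def ptil (z : ℝ × ℝ) : ℝ := |z.1| / max (1 - z.1 * z.2) (1 / 2)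

theorem gam_aux (hα : α ∈ Set.Ioo (0 : ℝ) 1) (hirr : Irrational α) (n : ℕ) :
    zz α (gam α n) ∈ RR ∧ ptil (zz α (gam α n)) = gaussMap^[n] α := by
  have hd0 := cfD_pos hα hirr n
  have hd1 := cfD_pos hα hirr (n+1)
  have hdl := cfD_lt hα hirr n
  have hds := cfD_succ hα hirr n
  have hdet := cf_det_real (α := α) n
  obtain ⟨k1, k2, k3⟩ := cfQ_aux hα hirr n
  have q0 : (0 : ℝ) ≤ cfQ α n := by exact_mod_cast k1
  have q01 : (cfQ α n : ℝ) ≤ cfQ α (n+1) := by exact_mod_cast k2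
  have q1 : (1 : ℝ) ≤ cfQ α (n+1) := by exact_mod_cast k3
  rw [zz_gam]
  generalize gaussMap^[n] α = x at *
  generalize cfD α (n+1) = d1 at *
  generalize cfD α n = d0 at *
  generalize (cfQ α n : ℝ) = y0 at *
  generalize (cfQ α (n+1) : ℝ) = y1 at *
  have y1p : 0 < y1 := by linarith
  have hsq := sgn_sq_real n
  have habs : |(-1 : ℝ) ^ n| = 1 := by simp
  have e1 : |(-1 : ℝ) ^ n * (d1 * y1)| = d1 * y1 := by
    rw [abs_mul, habs, one_mul, abs_of_nonneg (by positivity)]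
  have e2 : |(-1 : ℝ) ^ n * (y0 / y1)| = y0 / y1 := by
    rw [abs_mul, habs, one_mul, abs_of_nonneg (by positivity)]
  have e3 : (-1 : ℝ) ^ n * (d1 * y1) * ((-1) ^ n * (y0 / y1)) = d1 * y0 := by
    have e4 : d1 * y1 * (y0 / y1) = d1 * y0 := by field_simp
    linear_combination d1 * y1 * (y0 / y1) * hsq + e4
  constructor
  · refine ⟨?_, ?_, ?_⟩
    · simp only; rw [e2, div_le_one y1p]; exact q01
    · simp only; rw [e3]; positivity
    · simp only; rw [e1, e2]
      have : d1 * y1 * (1 + y0 / y1) = d1 * y1 + d1 * y0 := by field_simp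
      rw [this]; nlinarith
  · unfold ptil
    simp only
    rw [e1, e3, max_eq_left (by nlinarith)]
    have : 1 - d1 * y0 = d0 * y1 := by linarith
    rw [this, hds]
    field_simp

theorem gam_conv (hα : α ∈ Set.Ioo (0 : ℝ) 1) (hirr : Irrational α) (γ : SLZ 2)
    (hq : 0 < qq γ) (hz : zz α γ ∈ RO) : ∃ n, γ = gam α n := by
  obtain ⟨p1, p2, q1, q2, hdet, hM⟩ := slz_entries γ
  unfold qq at hq
  unfold zz at hz
  rw [hM] at hq hz
  obtain ⟨z1, z2, z3⟩ := hz
  simp only [Matrix.of_apply, Matrix.cons_val', Matrix.cons_val_zero,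
    Matrix.cons_val_one, Matrix.cons_val_fin_one] at hq z1 z2 z3
  have hdr : (p1 : ℝ) * q2 - p2 * q1 = 1 := by exact_mod_cast hdet
  have hq2 : 0 < q2 := by exact_mod_cast hq
  have hBC : -((p2 : ℝ) - α * q2) * q2 * (q1 / q2) = -(p2 - α * q2) * q1 := by
    field_simp
  rw [hBC] at z2
  have h3 : |-((p2 : ℝ) - α * q2) * q2| * (1 + |(q1 / q2 : ℝ)|) =
      |-((p2 : ℝ) - α * q2)| * (q2 + |(q1:ℝ)|) := by
    rw [abs_mul, abs_div, abs_of_pos hq]; field_simp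
  rw [h3] at z3
  rw [abs_div, abs_of_pos hq, div_lt_one hq] at z1
  have hfin : ∀ n : ℕ, p1 = (-1) ^ n * cfP α n → p2 = cfP α (n+1) → q1 = (-1) ^ n * cfQ α n →
      q2 = cfQ α (n+1) → ∃ n, γ = gam α n := by
    intro n h1 h2 h3 h4
    refine ⟨n, ?_⟩
    apply Subtype.ext
    apply Subtype.ext
    rw [hM]
    unfold gam
    rw [slzMk_coe, h1, h2, h3, h4]
  rcases lt_trichotomy q1 0 with h | h | h
  · have hr : (q1 : ℝ) < 0 := by exact_mod_cast h
    have hB : 0 < (p2 : ℝ) - α * q2 := by nlinarith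
    rw [abs_of_neg hr] at z1 z3
    rw [abs_neg, abs_of_pos hB] at z3
    obtain ⟨n, i1, i2, i3, i4, i5⟩ := reduced_is_cf hα hirr (-q1).toNat (-p1) (-q1) p2 q2 (-1) (Or.inr rfl)
      (by omega) (by linear_combination -hdet) (by omega)
      (by have : ((-q1 : ℤ) : ℝ) < q2 := by push_cast; exact z1
          exact_mod_cast this) (by push_cast; linarith) (by
          push_cast
          have : (p2 - α * q2) * q2 < (p1 - α * q1) * q2 := by nlinarith
          nlinarith [lt_of_mul_lt_mul_right this hq.le])
    apply hfin n _ i3 _ i4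
    · rw [← i5, ← i1]; ring
    · rw [← i5, ← i2]; ring
  · rw [h] at z2; simp at z2
  · have hr : 0 < (q1 : ℝ) := by exact_mod_cast h
    have hB : 0 < -((p2 : ℝ) - α * q2) := by
      by_contra h'
      nlinarith
    rw [abs_of_pos hr] at z1 z3
    rw [abs_of_pos hB] at z3
    obtain ⟨n, i1, i2, i3, i4, i5⟩ := reduced_is_cf hα hirr (q1).toNat p1 q1 p2 q2 1 (Or.inl rfl)
      (by omega) hdet (by omega)
      (by exact_mod_cast z1) (by push_cast; linarith) (by
          push_cast
          have : -(p2 - α * q2) * q2 < (p1 - α * q1) * q2 := by nlinarith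
          nlinarith [lt_of_mul_lt_mul_right this hq.le])
    apply hfin n _ i3 _ i4
    · rw [← i5, ← i1]; ring
    · rw [← i5, ← i2]; ring

theorem upper_sum (hα : α ∈ Set.Ioo (0 : ℝ) 1) (hirr : Irrational α) {a : ℝ → SL 2}
    (ha : ∀ t, (a t : Matrix (Fin 2) (Fin 2) ℝ) = !![Real.exp t, 0; 0, Real.exp (-t)])
    {u : SL 2} (hu : (u : Matrix (Fin 2) (Fin 2) ℝ) = !![1, -α; 0, 1])
    {Φ : ℝ × ℝ → ℝ} (hc : Continuous Φ) (hs : HasCompactSupport Φ) (h0 : ∀ z, 0 ≤ Φ z)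
    {f : ℝ → ℝ} (hf : ∀ z ∈ RR, f (ptil z) ≤ Φ z) (N : ℕ) (hN : 2 ≤ N) :
    rhoK * ∑ n ∈ Finset.Ico 3 N, f (gaussMap^[n] α) ≤
      ∫ t in (0 : ℝ)..(Real.log (cfQ α N)), poinc (tf Φ) (a t * u) := by
  classical
  have hQN : (1 : ℝ) ≤ cfQ α N := by
    obtain ⟨k, rfl⟩ := Nat.exists_eq_add_of_le hN
    have := (cfQ_aux hα hirr (k+1)).2.2
    rw [show 2 + k = k + 1 + 1 by ring]
    exact_mod_cast this
  have hT : 0 ≤ Real.log (cfQ α N) := Real.log_nonneg hQN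
  have hsum := flow_int ha hu hc hs hT
  have hinj : Set.InjOn (gam α) (Finset.Ico 3 N : Finset ℕ) := by
    have hlt : ∀ i j : ℕ, 3 ≤ i → i < j → gam α i ≠ gam α j := by
      intro i j hi hij h
      have h2 : qq (gam α i) = qq (gam α j) := by rw [h]
      rw [qq_gam, qq_gam] at h2
      have h3 : cfQ α (i+1) = cfQ α (j+1) := by exact_mod_cast h2
      obtain ⟨k, rfl⟩ := Nat.exists_eq_add_of_le hi
      have h4 := cfQ_lt hα hirr (2 + k)
      have h5 : cfQ α (2 + k + 3) ≤ cfQ α (j+1) := cfQ_mono hα hirr (by omega)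
      rw [show 3 + k + 1 = 2 + k + 2 by ring] at h3
      omega
    intro i hi j hj h
    simp only [Finset.coe_Ico, Set.mem_Ico] at hi hj
    rcases lt_trichotomy i j with h' | h' | h'
    · exact absurd h (hlt i j hi.1 h')
    · exact h'
    · exact absurd h.symm (hlt j i hj.1 h')
  have h1 := hsum.summable.sum_le_tsum ((Finset.Ico 3 N).image (gam α))
    (fun γ _ => mul_nonneg (wt_nonneg hT _) (h0 _))
  rw [hsum.tsum_eq, Finset.sum_image hinj] at h1
  refine le_trans ?_ h1
  rw [Finset.mul_sum]
  apply Finset.sum_le_sum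
  intro n hn
  rw [Finset.mem_Ico] at hn
  obtain ⟨hz, hp⟩ := gam_aux hα hirr n
  have hle : (cfQ α (n+1) : ℝ) ≤ cfQ α N := by exact_mod_cast cfQ_mono hα hirr (show n + 1 ≤ N by omega)
  have hge : (3 : ℝ) ≤ cfQ α (n+1) := by
    obtain ⟨k, rfl⟩ := Nat.exists_eq_add_of_le hn.1
    have := cfQ_ge hα hirr (k+2)
    rw [show 3 + k + 1 = k + 2 + 2 by ring]
    have h3 : (3 : ℤ) ≤ cfQ α (k+2+2) := by push_cast at this; omega
    exact_mod_cast h3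
  rw [qq_gam, wt_full (by linarith) _ (Real.log_le_log (by linarith) hle), ← hp]
  · exact mul_le_mul_of_nonneg_left (hf _ hz) rhoK_pos.le
  · rw [Real.le_log_iff_exp_le (by linarith)]
    linarith [Real.exp_one_lt_d9]

theorem lower_sum (hα : α ∈ Set.Ioo (0 : ℝ) 1) (hirr : Irrational α) {a : ℝ → SL 2}
    (ha : ∀ t, (a t : Matrix (Fin 2) (Fin 2) ℝ) = !![Real.exp t, 0; 0, Real.exp (-t)])
    {u : SL 2} (hu : (u : Matrix (Fin 2) (Fin 2) ℝ) = !![1, -α; 0, 1])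
    {Φ : ℝ × ℝ → ℝ} (hc : Continuous Φ) (hs : HasCompactSupport Φ) (h0 : ∀ z, 0 ≤ Φ z)
    {f : ℝ → ℝ} (hz0 : ∀ z, z ∉ RO → Φ z = 0) (hf : ∀ z, Φ z ≤ f (ptil z)) (N : ℕ) (hN : 2 ≤ N)
    (hT : 0 ≤ Real.log (cfQ α N) - 1) :
    ∫ t in (0 : ℝ)..(Real.log (cfQ α N) - 1), poinc (tf Φ) (a t * u) ≤
      rhoK * ∑ n ∈ Finset.range N, f (gaussMap^[n] α) := by
  classical
  have hQN : (1 : ℝ) ≤ cfQ α N := by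
    obtain ⟨k, rfl⟩ := Nat.exists_eq_add_of_le hN
    have := (cfQ_aux hα hirr (k+1)).2.2
    rw [show 2 + k = k + 1 + 1 by ring]
    exact_mod_cast this
  have hsum := flow_int ha hu hc hs hT
  have hnn : ∀ γ : SLZ 2, 0 ≤ wt (Real.log (cfQ α N) - 1) (qq γ) * Φ (zz α γ) :=
    fun γ => mul_nonneg (wt_nonneg hT _) (h0 _)
  have hvan : ∀ γ : SLZ 2, γ ∉ (Finset.range N).image (gam α) →
      wt (Real.log (cfQ α N) - 1) (qq γ) * Φ (zz α γ) = 0 := by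
    intro γ hγ
    by_contra hne
    apply hγ
    have hw := left_ne_zero_of_mul hne
    have hΦ := right_ne_zero_of_mul hne
    have hq : 0 < qq γ := by
      by_contra h'
      exact hw (wt_nonpos (not_lt.1 h'))
    have hz : zz α γ ∈ RO := by
      by_contra h'
      exact hΦ (hz0 _ h')
    obtain ⟨n, rfl⟩ := gam_conv hα hirr γ hq hz
    rw [Finset.mem_image]
    refine ⟨n, Finset.mem_range.2 ?_, rfl⟩
    apply cfQ_index hα hirr hN
    by_contra h'
    have h2 : (cfQ α N : ℝ) ≤ cfQ α (n+1) := by exact_mod_cast (not_le.1 h').le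
    apply hw
    apply wt_far hT hq
    rw [qq_gam, sub_add_cancel]
    exact Real.log_le_log (by linarith) h2
  rw [← hsum.tsum_eq, tsum_eq_sum hvan]
  refine (Finset.sum_image_le_of_nonneg (fun γ _ => hnn γ)).trans ?_
  rw [Finset.mul_sum]
  apply Finset.sum_le_sum
  intro n _
  obtain ⟨hz, hp⟩ := gam_aux hα hirr n
  rw [← hp]
  exact mul_le_mul (wt_le _) (hf _) (h0 _) rhoK_pos.le

end Flow

/-! ### Part 7 : limits -/

section Lim

theorem flow_lim (m : Measure (SL 2 ⧸ SLZ 2)) [IsProbabilityMeasure m]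
    (hminv : ∀ g : SL 2, Measure.map (fun x => g • x) m = m)
    (a : ℝ → SL 2) (u : SL 2)
    (hequi : ∀ F : BoundedContinuousFunction (SL 2 ⧸ SLZ 2) ℝ,
      Tendsto
        (fun T : ℝ => T⁻¹ * ∫ t in (0 : ℝ)..T,
          F ((a t * u) • ((1 : SL 2) : SL 2 ⧸ SLZ 2)))
        atTop (𝓝 (∫ x, F x ∂m))) :
    ∃ c0 : ℝ, 0 < c0 ∧ ∀ Φ : ℝ × ℝ → ℝ, Continuous Φ → HasCompactSupport Φ →
      Tendsto (fun T : ℝ => T⁻¹ * ∫ t in (0 : ℝ)..T, poinc (tf Φ) (a t * u)) atTop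
        (𝓝 (c0 * ∫ z, Φ z)) := by
  obtain ⟨c0, hc0, h⟩ := exists_unfold_const m hminv
  refine ⟨c0, hc0, fun Φ hc hs => ?_⟩
  rw [← h Φ hc hs]
  have := hequi (poincB (tf Φ) (tf_continuous hc) (tf_compact hs))
  have e : ∀ t, poincB (tf Φ) (tf_continuous hc) (tf_compact hs)
      ((a t * u) • ((1 : SL 2) : SL 2 ⧸ SLZ 2)) = poinc (tf Φ) (a t * u) := by
    intro t
    have : (a t * u) • ((1 : SL 2) : SL 2 ⧸ SLZ 2) = ((a t * u : SL 2) : SL 2 ⧸ SLZ 2) := by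
      rw [MulAction.Quotient.smul_coe, smul_eq_mul, mul_one]
    rw [this]; rfl
  simp only [e] at this
  exact this

variable {α : ℝ}

theorem irr_of_lim {a : ℝ → SL 2}
    (ha : ∀ t, (a t : Matrix (Fin 2) (Fin 2) ℝ) = !![Real.exp t, 0; 0, Real.exp (-t)])
    {u : SL 2} (hu : (u : Matrix (Fin 2) (Fin 2) ℝ) = !![1, -α; 0, 1]) {c0 : ℝ} (hc0 : 0 < c0)
    (hlim : ∀ Φ : ℝ × ℝ → ℝ, Continuous Φ → HasCompactSupport Φ →
      Tendsto (fun T : ℝ => T⁻¹ * ∫ t in (0 : ℝ)..T, poinc (tf Φ) (a t * u)) atTop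
        (𝓝 (c0 * ∫ z, Φ z))) : Irrational α := by
  rintro ⟨r, rfl⟩
  set Φ : ℝ × ℝ → ℝ := fun z => max 0 (1 / 4 - |z.1 - 1 / 2|) * max 0 (1 - |z.2|) with hΦ
  have hc : Continuous Φ := by fun_prop
  have h0 : 0 ≤ Φ := fun z => mul_nonneg (le_max_left _ _) (le_max_left _ _)
  have hsupp : ∀ z, Φ z ≠ 0 → |z.1 - 1 / 2| < 1 / 4 ∧ |z.2| < 1 := by
    intro z hz
    have h1 := left_ne_zero_of_mul hz
    have h2 := right_ne_zero_of_mul hz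
    constructor
    · by_contra h'; exact h1 (max_eq_left (by linarith))
    · by_contra h'; exact h2 (max_eq_left (by linarith))
  have hs : HasCompactSupport Φ := by
    apply HasCompactSupport.of_support_subset_isCompact (isCompact_closedBall (0 : ℝ × ℝ) 1)
    intro z hz
    obtain ⟨h1, h2⟩ := hsupp z hz
    rw [mem_closedBall_zero_iff, Prod.norm_def]
    rw [abs_lt] at h1
    refine max_le ?_ h2.le
    rw [Real.norm_eq_abs, abs_le]
    constructor <;> linarith
  have hpos : 0 < ∫ z, Φ z := by
    apply hc.integral_pos_of_hasCompactSupport_nonneg_nonzero hs h0 (x := (1 / 2, 0))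
    simp [hΦ]
  set b : ℝ := ((r.den : ℕ) : ℝ) with hb
  have hb1 : 1 ≤ b := by rw [hb]; exact_mod_cast r.den_pos
  have hvan : ∀ t, Real.log b ≤ t → poinc (tf Φ) (a t * u) = 0 := by
    intro t ht
    by_contra hne
    obtain ⟨γ, hγ⟩ := poinc_eq_zero hne
    rw [tf_flow ha hu] at hγ
    obtain ⟨p1, -⟩ := psi_ne_zero (left_ne_zero_of_mul hγ)
    obtain ⟨p2, -⟩ := hsupp _ (right_ne_zero_of_mul hγ)
    obtain ⟨x1, x2, y1, y2, -, hM⟩ := slz_entries γ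
    unfold qq at p1
    unfold zz at p2
    rw [hM] at p1 p2
    simp only [Matrix.of_apply, Matrix.cons_val', Matrix.cons_val_zero,
      Matrix.cons_val_one, Matrix.cons_val_fin_one] at p1 p2
    have hy : 0 < (y2 : ℝ) := by
      by_contra h'
      nlinarith [Real.exp_pos (-t)]
    have hrb : (r : ℝ) * b = r.num := by
      rw [hb]; exact_mod_cast Rat.mul_den_eq_num r
    have hyb : (y2 : ℝ) ≤ b := by
      set k : ℤ := -(x2 * r.den - r.num * y2) with hk
      have hkr : (k : ℝ) = -(x2 - r * y2) * b := by
        rw [hk]; push_cast; rw [← hrb]; ring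
      rw [abs_lt] at p2
      have h1 : 0 < -((x2 : ℝ) - r * y2) * y2 := by linarith
      have h2 : 0 < -((x2 : ℝ) - r * y2) := by
        by_contra h'; nlinarith
      have h3 : 0 < (k : ℝ) := by rw [hkr]; positivity
      have h4 : 0 < k := by exact_mod_cast h3
      have h5 : (1 : ℝ) ≤ k := by exact_mod_cast h4
      nlinarith
    have h6 : b ≤ Real.exp t := by
      rw [Real.log_le_iff_le_exp (by linarith)] at ht; exact ht
    have h7 : Real.exp (-t) * Real.exp t = 1 := by rw [← Real.exp_add]; simp
    nlinarith [Real.exp_pos (-t)]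
  have hii : ∀ x y : ℝ, IntervalIntegrable (fun t => poinc (tf Φ) (a t * u)) volume x y :=
    fun x y => ((poinc_continuous (tf_continuous hc) (tf_compact hs)).comp
      (flow_cont ha u)).intervalIntegrable x y
  have h1 := hlim Φ hc hs
  have h2 : Tendsto (fun T : ℝ => T⁻¹ * ∫ t in (0 : ℝ)..T, poinc (tf Φ) (a t * u)) atTop (𝓝 0) := by
    have h3 : Tendsto (fun T : ℝ => T⁻¹ * ∫ t in (0 : ℝ)..(Real.log b), poinc (tf Φ) (a t * u))
        atTop (𝓝 0) := by
      simpa using tendsto_inv_atTop_zero.mul_const (∫ t in (0 : ℝ)..(Real.log b), poinc (tf Φ) (a t * u))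
    refine h3.congr' ?_
    filter_upwards [eventually_ge_atTop (Real.log b)] with T hT
    congr 1
    rw [← intervalIntegral.integral_add_adjacent_intervals (hii 0 (Real.log b)) (hii (Real.log b) T)]
    rw [intervalIntegral.integral_congr (a := Real.log b) (g := fun _ => (0 : ℝ)) (fun t ht => ?_)]
    · simp
    · rw [Set.uIcc_of_le hT] at ht
      exact hvan t ht.1
  have := tendsto_nhds_unique h1 h2
  have : 0 < c0 * ∫ z, Φ z := mul_pos hc0 hpos
  linarith

theorem RR_closed : IsClosed RR := by
  have h1 : IsClosed {z : ℝ × ℝ | |z.2| ≤ 1} := isClosed_le (by fun_prop) (by fun_prop)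
  have h2 : IsClosed {z : ℝ × ℝ | 0 ≤ z.1 * z.2} := isClosed_le (by fun_prop) (by fun_prop)
  have h3 : IsClosed {z : ℝ × ℝ | |z.1| * (1 + |z.2|) ≤ 1} := isClosed_le (by fun_prop) (by fun_prop)
  exact h1.inter (h2.inter h3)

theorem RO_open : IsOpen RO := by
  have h1 : IsOpen {z : ℝ × ℝ | |z.2| < 1} := isOpen_lt (by fun_prop) (by fun_prop)
  have h2 : IsOpen {z : ℝ × ℝ | 0 < z.1 * z.2} := isOpen_lt (by fun_prop) (by fun_prop)
  have h3 : IsOpen {z : ℝ × ℝ | |z.1| * (1 + |z.2|) < 1} := isOpen_lt (by fun_prop) (by fun_prop)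
  exact h1.inter (h2.inter h3)

theorem RO_sub : RO ⊆ RR := fun _ h => ⟨h.1.le, h.2.1.le, h.2.2.le⟩

theorem RR_bdd {z : ℝ × ℝ} (h : z ∈ RR) : ‖z‖ ≤ 1 := by
  obtain ⟨h1, h2, h3⟩ := h
  rw [Prod.norm_def]
  refine max_le ?_ h1
  rw [Real.norm_eq_abs]
  nlinarith [abs_nonneg z.1, abs_nonneg z.2]

theorem ptil_continuous : Continuous ptil := by
  unfold ptil
  refine Continuous.div (by fun_prop) (by fun_prop) (fun z => ?_)
  have : (1 / 2 : ℝ) ≤ max (1 - z.1 * z.2) (1 / 2) := le_max_right _ _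
  linarith

theorem RR_diff_null : volume (RR \ RO) = 0 := by
  have hsub : RR \ RO ⊆ {z : ℝ × ℝ | |z.2| = 1 ∨ z.1 * z.2 = 0 ∨ |z.1| * (1 + |z.2|) = 1} := by
    rintro z ⟨⟨h1, h2, h3⟩, hz⟩
    by_contra h'
    simp only [Set.mem_ofPred_eq, not_or] at h'
    exact hz ⟨lt_of_le_of_ne h1 h'.1, lt_of_le_of_ne h2 (Ne.symm h'.2.1), lt_of_le_of_ne h3 h'.2.2⟩
  refine measure_mono_null hsub ?_
  rw [Measure.volume_eq_prod, Measure.measure_prod_null]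
  · have : ∀ᵐ x : ℝ, x ≠ 0 := by simp [ae_iff]
    filter_upwards [this] with x hx
    have hfin : ({1, -1, 0, |x|⁻¹ - 1, -(|x|⁻¹ - 1)} : Set ℝ).Finite := Set.toFinite _
    refine measure_mono_null ?_ (hfin.measure_zero volume)
    intro c hc
    simp only [Set.mem_preimage, Set.mem_ofPred_eq] at hc
    rcases hc with h | h | h
    · rcases eq_or_eq_neg_of_abs_eq h with h | h <;> simp [h]
    · rcases mul_eq_zero.1 h with h | h
      · exact absurd h hx
      · simp [h]
    · have hx' : 0 < |x| := abs_pos.2 hx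
      have : |c| = |x|⁻¹ - 1 := by field_simp; linarith
      rcases eq_or_eq_neg_of_abs_eq this with h | h <;> simp [h]
  · have h1 : IsClosed {z : ℝ × ℝ | |z.2| = 1} := isClosed_eq (by fun_prop) (by fun_prop)
    have h2 : IsClosed {z : ℝ × ℝ | z.1 * z.2 = 0} := isClosed_eq (by fun_prop) (by fun_prop)
    have h3 : IsClosed {z : ℝ × ℝ | |z.1| * (1 + |z.2|) = 1} :=
      isClosed_eq (by fun_prop) (by fun_prop)
    exact (h1.union (h2.union h3)).measurableSet

theorem approx_upper {f : ℝ → ℝ} (hf : Continuous f) (h0 : ∀ x, 0 ≤ f x) {C : ℝ} (hC : ∀ x, f x ≤ C) :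
    ∃ Φ : ℕ → ℝ × ℝ → ℝ, (∀ k, Continuous (Φ k)) ∧ (∀ k, HasCompactSupport (Φ k)) ∧
      (∀ k z, 0 ≤ Φ k z) ∧ (∀ k, ∀ z ∈ RR, f (ptil z) ≤ Φ k z) ∧
      Tendsto (fun k => ∫ z, Φ k z) atTop (𝓝 (∫ z in RR, f (ptil z))) := by
  have hC0 : 0 ≤ C := (h0 0).trans (hC 0)
  have hne : RR.Nonempty := ⟨0, by simp [RR]⟩
  set Φ : ℕ → ℝ × ℝ → ℝ := fun k z => f (ptil z) * max 0 (1 - ((k : ℝ) + 1) * Metric.infDist z RR) with hΦ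
  have hnn : ∀ k z, 0 ≤ Φ k z := fun k z => mul_nonneg (h0 _) (le_max_left _ _)
  have hcont : ∀ k, Continuous (Φ k) := fun k => (hf.comp ptil_continuous).mul
      (continuous_const.max (continuous_const.sub (continuous_const.mul (Metric.continuous_infDist_pt _))))
  have hsupp : ∀ k z, Φ k z ≠ 0 → z ∈ Metric.closedBall (0 : ℝ × ℝ) 2 := by
    intro k z hz
    have h1 := right_ne_zero_of_mul hz
    have h2 : Metric.infDist z RR < 1 := by
      by_contra h'
      apply h1
      apply max_eq_left
      have : (0 : ℝ) ≤ k := by positivity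
      nlinarith
    obtain ⟨y, hy, hd⟩ := (Metric.infDist_lt_iff hne).1 h2
    have := RR_bdd hy
    rw [mem_closedBall_zero_iff]
    have h3 : ‖z‖ ≤ ‖y‖ + ‖z - y‖ := by
      have := norm_add_le y (z - y)
      simpa using this
    rw [dist_eq_norm] at hd
    linarith
  refine ⟨Φ, hcont, fun k => ?_, hnn, ?_, ?_⟩
  · exact HasCompactSupport.of_support_subset_isCompact (isCompact_closedBall (0 : ℝ × ℝ) 2)
      (fun z hz => hsupp k z hz)
  · intro k z hz
    simp [hΦ, Metric.infDist_zero_of_mem hz]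
  · rw [← integral_indicator RR_closed.measurableSet]
    apply tendsto_integral_of_dominated_convergence
      ((Metric.closedBall (0 : ℝ × ℝ) 2).indicator (fun _ => C))
    · exact fun k => (hcont k).aestronglyMeasurable
    · rw [integrable_indicator_iff Metric.isClosed_closedBall.measurableSet]
      exact integrableOn_const (isCompact_closedBall _ _).measure_lt_top.ne
    · intro k
      refine Eventually.of_forall (fun z => ?_)
      rw [Real.norm_of_nonneg (hnn k z)]
      by_cases hz : Φ k z = 0
      · rw [hz]; exact Set.indicator_nonneg (fun _ _ => hC0) _
      · rw [Set.indicator_of_mem (hsupp k z hz)]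
        calc Φ k z ≤ C * 1 := mul_le_mul (hC _) (max_le zero_le_one (by
              have := Metric.infDist_nonneg (x := z) (s := RR)
              have : 0 ≤ ((k : ℝ) + 1) * Metric.infDist z RR := by positivity
              linarith)) (le_max_left _ _) hC0
          _ = C := mul_one C
    · refine Eventually.of_forall (fun z => ?_)
      by_cases hz : z ∈ RR
      · rw [Set.indicator_of_mem hz]
        refine tendsto_const_nhds.congr (fun k => ?_)
        simp [hΦ, Metric.infDist_zero_of_mem hz]
      · rw [Set.indicator_of_notMem hz]
        have hd : 0 < Metric.infDist z RR := (RR_closed.notMem_iff_infDist_pos hne).1 hz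
        obtain ⟨k0, hk0⟩ := exists_nat_gt (Metric.infDist z RR)⁻¹
        refine tendsto_const_nhds.congr' ?_
        filter_upwards [eventually_ge_atTop k0] with k hk
        have hk' : (k0 : ℝ) ≤ k := by exact_mod_cast hk
        have : 1 < (k : ℝ) * Metric.infDist z RR := by
          rw [inv_lt_iff_one_lt_mul₀ hd] at hk0
          nlinarith
        simp only [hΦ]
        rw [max_eq_left (by nlinarith), mul_zero]

theorem approx_lower {f : ℝ → ℝ} (hf : Continuous f) (h0 : ∀ x, 0 ≤ f x) {C : ℝ} (hC : ∀ x, f x ≤ C) :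
    ∃ Φ : ℕ → ℝ × ℝ → ℝ, (∀ k, Continuous (Φ k)) ∧ (∀ k, HasCompactSupport (Φ k)) ∧
      (∀ k z, 0 ≤ Φ k z) ∧ (∀ k z, z ∉ RO → Φ k z = 0) ∧ (∀ k z, Φ k z ≤ f (ptil z)) ∧
      Tendsto (fun k => ∫ z, Φ k z) atTop (𝓝 (∫ z in RR, f (ptil z))) := by
  have hC0 : 0 ≤ C := (h0 0).trans (hC 0)
  have hne : (ROᶜ).Nonempty := ⟨0, by simp [RO]⟩
  set Φ : ℕ → ℝ × ℝ → ℝ := fun k z => f (ptil z) * min 1 ((k : ℝ) * Metric.infDist z ROᶜ) with hΦ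
  have hmn : ∀ (k : ℕ) z, 0 ≤ min 1 ((k : ℝ) * Metric.infDist z ROᶜ) := fun k z =>
    le_min zero_le_one (mul_nonneg (by positivity) Metric.infDist_nonneg)
  have hnn : ∀ k z, 0 ≤ Φ k z := fun k z => mul_nonneg (h0 _) (hmn k z)
  have hcont : ∀ k, Continuous (Φ k) := fun k => (hf.comp ptil_continuous).mul
      (continuous_const.min (continuous_const.mul (Metric.continuous_infDist_pt _)))
  have hz0 : ∀ k z, z ∉ RO → Φ k z = 0 := by
    intro k z hz
    simp [hΦ, Metric.infDist_zero_of_mem (show z ∈ ROᶜ from hz)]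
  have hle : ∀ k z, Φ k z ≤ f (ptil z) := by
    intro k z
    calc Φ k z ≤ f (ptil z) * 1 := mul_le_mul_of_nonneg_left (min_le_left _ _) (h0 _)
      _ = _ := mul_one _
  have hsupp : ∀ k z, Φ k z ≠ 0 → z ∈ Metric.closedBall (0 : ℝ × ℝ) 1 := by
    intro k z hz
    rw [mem_closedBall_zero_iff]
    apply RR_bdd
    apply RO_sub
    by_contra h'
    exact hz (hz0 k z h')
  refine ⟨Φ, hcont, fun k => ?_, hnn, hz0, hle, ?_⟩
  · exact HasCompactSupport.of_support_subset_isCompact (isCompact_closedBall (0 : ℝ × ℝ) 1)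
      (fun z hz => hsupp k z hz)
  · have hae : RO =ᵐ[volume] RR := by
      apply Filter.EventuallyLE.antisymm (LE.le.eventuallyLE RO_sub)
      rw [ae_le_set]; exact RR_diff_null
    rw [← setIntegral_congr_set hae, ← integral_indicator RO_open.measurableSet]
    apply tendsto_integral_of_dominated_convergence
      ((Metric.closedBall (0 : ℝ × ℝ) 1).indicator (fun _ => C))
    · exact fun k => (hcont k).aestronglyMeasurable
    · rw [integrable_indicator_iff Metric.isClosed_closedBall.measurableSet]
      exact integrableOn_const (isCompact_closedBall _ _).measure_lt_top.ne
    · intro k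
      refine Eventually.of_forall (fun z => ?_)
      rw [Real.norm_of_nonneg (hnn k z)]
      by_cases hz : Φ k z = 0
      · rw [hz]; exact Set.indicator_nonneg (fun _ _ => hC0) _
      · rw [Set.indicator_of_mem (hsupp k z hz)]
        exact (hle k z).trans (hC _)
    · refine Eventually.of_forall (fun z => ?_)
      by_cases hz : z ∈ RO
      · rw [Set.indicator_of_mem hz]
        have hd : 0 < Metric.infDist z ROᶜ :=
          (RO_open.isClosed_compl.notMem_iff_infDist_pos hne).1 (by simpa using hz)
        obtain ⟨k0, hk0⟩ := exists_nat_gt (Metric.infDist z ROᶜ)⁻¹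
        refine tendsto_const_nhds.congr' ?_
        filter_upwards [eventually_ge_atTop k0] with k hk
        have hk' : (k0 : ℝ) ≤ k := by exact_mod_cast hk
        have : 1 < (k : ℝ) * Metric.infDist z ROᶜ := by
          rw [inv_lt_iff_one_lt_mul₀ hd] at hk0
          nlinarith
        simp only [hΦ]
        rw [min_eq_left this.le, mul_one]
      · rw [Set.indicator_of_notMem hz]
        refine tendsto_const_nhds.congr (fun k => (hz0 k z hz).symm)

theorem logQ_tendsto (hα : α ∈ Set.Ioo (0 : ℝ) 1) (hirr : Irrational α) :
    Tendsto (fun N : ℕ => Real.log (cfQ α N)) atTop atTop := by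
  apply Real.tendsto_log_atTop.comp
  rw [← tendsto_add_atTop_iff_nat 2]
  refine tendsto_atTop_mono (fun n => ?_) tendsto_natCast_atTop_atTop
  have := cfQ_ge hα hirr n
  have h2 : (n : ℤ) ≤ cfQ α (n+2) := by omega
  exact_mod_cast h2

theorem sum_lim (hα : α ∈ Set.Ioo (0 : ℝ) 1) (hirr : Irrational α) {a : ℝ → SL 2}
    (ha : ∀ t, (a t : Matrix (Fin 2) (Fin 2) ℝ) = !![Real.exp t, 0; 0, Real.exp (-t)])
    {u : SL 2} (hu : (u : Matrix (Fin 2) (Fin 2) ℝ) = !![1, -α; 0, 1]) {c0 : ℝ} (hc0 : 0 < c0)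
    (hlim : ∀ Φ : ℝ × ℝ → ℝ, Continuous Φ → HasCompactSupport Φ →
      Tendsto (fun T : ℝ => T⁻¹ * ∫ t in (0 : ℝ)..T, poinc (tf Φ) (a t * u)) atTop
        (𝓝 (c0 * ∫ z, Φ z)))
    {f : ℝ → ℝ} (hf : Continuous f) (h0 : ∀ x, 0 ≤ f x) {C : ℝ} (hC : ∀ x, f x ≤ C) :
    Tendsto (fun N : ℕ => (Real.log (cfQ α N))⁻¹ * (rhoK * ∑ n ∈ Finset.range N, f (gaussMap^[n] α)))
      atTop (𝓝 (c0 * ∫ z in RR, f (ptil z))) := by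
  have hQ := logQ_tendsto hα hirr
  rw [tendsto_order]
  constructor
  · intro b hb
    obtain ⟨Φ, h1, h2, h3, h4, h5, h6⟩ := approx_lower hf h0 hC
    have h7 := h6.const_mul c0
    obtain ⟨k, hk⟩ := ((tendsto_order.1 h7).1 b hb).exists
    have h8 := (hlim (Φ k) (h1 k) (h2 k)).comp (tendsto_atTop_add_const_right _ (-1) hQ)
    have h9 : Tendsto (fun N : ℕ => (Real.log (cfQ α N))⁻¹ * (Real.log (cfQ α N) + -1)) atTop (𝓝 1) := by
      have : Tendsto (fun N : ℕ => 1 + (Real.log (cfQ α N))⁻¹ * (-1)) atTop (𝓝 1) := by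
        simpa using ((tendsto_inv_atTop_zero.comp hQ).mul_const (-1)).const_add 1
      refine this.congr' ?_
      filter_upwards [hQ.eventually_gt_atTop 0] with N hN
      field_simp
    have h10 := h9.mul h8
    rw [one_mul] at h10
    filter_upwards [(tendsto_order.1 h10).1 b hk, hQ.eventually_gt_atTop 1, eventually_ge_atTop 2]
      with N hN1 hN2 hN3
    refine hN1.trans_le ?_
    have hl := lower_sum hα hirr ha hu (h1 k) (h2 k) (h3 k) (h4 k) (h5 k) N hN3 (by linarith)
    rw [sub_eq_add_neg] at hl
    simp only [Function.comp]
    have hne : Real.log (cfQ α N) + -1 ≠ 0 := by linarith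
    rw [mul_assoc, mul_inv_cancel_left₀ hne]
    exact mul_le_mul_of_nonneg_left hl (by positivity)
  · intro b hb
    obtain ⟨Φ, h1, h2, h3, h4, h6⟩ := approx_upper hf h0 hC
    have h7 := h6.const_mul c0
    obtain ⟨k, hk⟩ := ((tendsto_order.1 h7).2 b hb).exists
    have h8 := (hlim (Φ k) (h1 k) (h2 k)).comp hQ
    have h9 : Tendsto (fun N : ℕ => (Real.log (cfQ α N))⁻¹ *
        (rhoK * ∑ n ∈ Finset.range 3, f (gaussMap^[n] α))) atTop (𝓝 0) := by
      simpa using (tendsto_inv_atTop_zero.comp hQ).mul_const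
        (rhoK * ∑ n ∈ Finset.range 3, f (gaussMap^[n] α))
    have h10 := h9.add h8
    rw [zero_add] at h10
    filter_upwards [(tendsto_order.1 h10).2 b hk, hQ.eventually_gt_atTop 1, eventually_ge_atTop 3]
      with N hN1 hN2 hN3
    refine lt_of_le_of_lt ?_ hN1
    have hl := upper_sum hα hirr ha hu (h1 k) (h2 k) (h3 k) (h4 k) N (by omega)
    simp only [Function.comp]
    rw [← mul_add]
    apply mul_le_mul_of_nonneg_left _ (by positivity)
    rw [← Finset.sum_range_add_sum_Ico _ hN3, mul_add]
    linarith

end Lim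

/-! ### Part 8 : the limiting integral -/

/-- inner integral -/
def innerH (f : ℝ → ℝ) (c : ℝ) : ℝ := ∫ p in (0 : ℝ)..1, f p * (1 / (1 + p * c) ^ 2)

theorem slice_pos {f : ℝ → ℝ} (hf : Continuous f) {c : ℝ} (h0 : 0 < c) (h1 : c ≤ 1) :
    ∫ b, RR.indicator (fun z => f (ptil z)) (b, c) = innerH f c := by
  have e : ∀ b, RR.indicator (fun z => f (ptil z)) (b, c) =
      (Set.Icc 0 (1 / (1 + c))).indicator (fun b => f (ptil (b, c))) b := by
    intro b
    have hiff : (b, c) ∈ RR ↔ b ∈ Set.Icc 0 (1 / (1 + c)) := by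
      unfold RR
      simp only [Set.mem_ofPred_eq, Set.mem_Icc]
      rw [abs_of_pos h0, le_div_iff₀ (by linarith)]
      constructor
      · rintro ⟨-, h2, h3⟩
        have hb : 0 ≤ b := by by_contra h'; nlinarith
        rw [abs_of_nonneg hb] at h3
        exact ⟨hb, h3⟩
      · rintro ⟨hb, h3⟩
        rw [abs_of_nonneg hb]
        exact ⟨h1, by positivity, h3⟩
    by_cases h : (b, c) ∈ RR
    · rw [Set.indicator_of_mem h, Set.indicator_of_mem (hiff.1 h)]
    · rw [Set.indicator_of_notMem h, Set.indicator_of_notMem (fun h' => h (hiff.2 h'))]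
  simp only [e]
  have hle : (0 : ℝ) ≤ 1 / (1 + c) := by positivity
  rw [integral_indicator measurableSet_Icc, integral_Icc_eq_integral_Ioc,
    ← intervalIntegral.integral_of_le hle]
  have hsub := intervalIntegral.integral_comp_mul_deriv (a := 0) (b := 1)
    (f := fun p => p / (1 + p * c)) (f' := fun p => 1 / (1 + p * c) ^ 2)
    (g := fun b => f (ptil (b, c))) (by
      intro p hp
      rw [Set.uIcc_of_le zero_le_one] at hp
      have hpos : 0 < 1 + p * c := by nlinarith [hp.1]
      have hd := (hasDerivAt_id p).div (((hasDerivAt_id p).mul_const c).const_add 1) hpos.ne'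
      refine hd.congr_deriv ?_
      simp only [id]
      field_simp
      ring) (by
      intro p hp
      rw [Set.uIcc_of_le zero_le_one] at hp
      have hpos : 0 < 1 + p * c := by nlinarith [hp.1]
      apply ContinuousAt.continuousWithinAt
      have : (1 + p * c) ^ 2 ≠ 0 := by positivity
      fun_prop (disch := assumption)) (hf.comp (ptil_continuous.comp (by fun_prop)))
  simp only [zero_div, one_mul, zero_mul] at hsub
  rw [← hsub]
  unfold innerH
  apply intervalIntegral.integral_congr
  intro p hp
  rw [Set.uIcc_of_le zero_le_one] at hp
  have hpos : 0 < 1 + p * c := by nlinarith [hp.1]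
  simp only [Function.comp]
  congr 2
  unfold ptil
  simp only
  have e1 : 1 - p / (1 + p * c) * c = 1 / (1 + p * c) := by field_simp; ring
  rw [e1, max_eq_left, abs_of_nonneg (div_nonneg hp.1 hpos.le)]
  · field_simp
  · apply one_div_le_one_div_of_le hpos
    nlinarith [hp.1, hp.2]

theorem slice_all {f : ℝ → ℝ} (hf : Continuous f) {c : ℝ} (h0 : c ≠ 0) :
    ∫ b, RR.indicator (fun z => f (ptil z)) (b, c) = (Set.Iic 1).indicator (innerH f) |c| := by
  by_cases h1 : |c| ≤ 1
  · rw [Set.indicator_of_mem (show |c| ∈ Set.Iic 1 from h1)]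
    rcases lt_or_gt_of_ne h0 with h | h
    · rw [abs_of_neg h] at h1 ⊢
      rw [← slice_pos hf (neg_pos.2 h) h1]
      rw [← integral_neg_eq_self]
      congr 1
      ext b
      have hiff : (-b, c) ∈ RR ↔ (b, -c) ∈ RR := by
        unfold RR
        simp only [Set.mem_ofPred_eq, abs_neg, neg_mul, mul_neg]
      have hp : ptil (-b, c) = ptil (b, -c) := by
        unfold ptil
        simp only [abs_neg, neg_mul, mul_neg]
      by_cases h : (b, -c) ∈ RR
      · rw [Set.indicator_of_mem h, Set.indicator_of_mem (hiff.2 h), hp]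
      · rw [Set.indicator_of_notMem h, Set.indicator_of_notMem (fun h' => h (hiff.1 h'))]
    · rw [abs_of_pos h] at h1 ⊢
      exact slice_pos hf h h1
  · rw [Set.indicator_of_notMem (show |c| ∉ Set.Iic 1 from h1)]
    have : ∀ b, RR.indicator (fun z => f (ptil z)) (b, c) = 0 := fun b =>
      Set.indicator_of_notMem (fun h => h1 h.1) _
    simp [this]

theorem region_integral {f : ℝ → ℝ} (hf : Continuous f) :
    ∫ z in RR, f (ptil z) = 2 * ∫ p in (0 : ℝ)..1, f p / (1 + p) := by
  have hcomp : IsCompact RR := by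
    apply Metric.isCompact_of_isClosed_isBounded RR_closed
    exact isBounded_iff_forall_norm_le.2 ⟨1, fun z hz => RR_bdd hz⟩
  have hIntg : Integrable (RR.indicator (fun z => f (ptil z))) volume := by
    rw [integrable_indicator_iff RR_closed.measurableSet]
    exact (hf.comp ptil_continuous).continuousOn.integrableOn_compact hcomp
  rw [← integral_indicator RR_closed.measurableSet]
  rw [Measure.volume_eq_prod] at hIntg ⊢
  rw [integral_prod_symm _ hIntg]
  have hae : ∀ᵐ x : ℝ, x ≠ 0 := by simp [ae_iff]
  have h1 : ∫ c, ∫ b, RR.indicator (fun z => f (ptil z)) (b, c) =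
      ∫ c : ℝ, (Set.Iic 1).indicator (innerH f) |c| := by
    apply integral_congr_ae
    filter_upwards [hae] with c hc
    exact slice_all hf hc
  rw [h1, integral_comp_abs (f := (Set.Iic 1).indicator (innerH f)),
    setIntegral_indicator measurableSet_Iic, Set.Ioi_inter_Iic,
    ← intervalIntegral.integral_of_le zero_le_one]
  congr 1
  unfold innerH
  rw [intervalIntegral_intervalIntegral_swap]
  · apply intervalIntegral.integral_congr
    intro p hp
    rw [Set.uIcc_of_le zero_le_one] at hp
    simp only
    rw [intervalIntegral.integral_const_mul, div_eq_mul_inv]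
    congr 1
    have hd : ∀ c ∈ Set.uIcc (0 : ℝ) 1, HasDerivAt (fun c => c / (1 + p * c)) (1 / (1 + p * c) ^ 2) c := by
      intro c hc
      rw [Set.uIcc_of_le zero_le_one] at hc
      have hpos : 0 < 1 + p * c := by nlinarith [hp.1, hc.1]
      have hd := (hasDerivAt_id c).div (((hasDerivAt_id c).const_mul p).const_add 1) hpos.ne'
      refine hd.congr_deriv ?_
      simp only [id]
      field_simp
      ring
    rw [intervalIntegral.integral_eq_sub_of_hasDerivAt hd]
    · simp
    · apply ContinuousOn.intervalIntegrable
      intro c hc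
      rw [Set.uIcc_of_le zero_le_one] at hc
      have hpos : 0 < 1 + p * c := by nlinarith [hp.1, hc.1]
      have : (1 + p * c) ^ 2 ≠ 0 := by positivity
      apply ContinuousAt.continuousWithinAt
      fun_prop (disch := assumption)
  · have hK : IsCompact (Set.Icc (0 : ℝ) 1 ×ˢ Set.Icc (0 : ℝ) 1) := isCompact_Icc.prod isCompact_Icc
    refine IntegrableOn.mono_set (ContinuousOn.integrableOn_compact hK ?_) (Set.prod_mono ?_ ?_)
    · rintro ⟨c, p⟩ ⟨hc, hp⟩
      simp only at hc hp
      have hpos : 0 < 1 + p * c := by nlinarith [hp.1, hc.1, mul_nonneg hp.1 hc.1]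
      have hne : (1 + p * c) ^ 2 ≠ 0 := by positivity
      apply ContinuousAt.continuousWithinAt
      have e : (Function.uncurry fun x p : ℝ => f p * (1 / (1 + p * x) ^ 2)) =
        fun z : ℝ × ℝ => f z.2 * (1 / (1 + z.2 * z.1) ^ 2) := rfl
      rw [e]
      refine ContinuousAt.mul (by fun_prop) (ContinuousAt.div (by fun_prop) (by fun_prop) hne)
    · rw [Set.uIoc_of_le zero_le_one]; exact Set.Ioc_subset_Icc_self
    · rw [Set.uIoc_of_le zero_le_one]; exact Set.Ioc_subset_Icc_self

/-- **Theorem.** Fix `α ∈ (0,1)` and suppose that the orbit `(a_t u_α x₀)_{t ≥ 0}` is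
equidistributed in `X = SL_2(ℝ)/SL_2(ℤ)` with respect to the invariant probability measure
`m`, where `a_t = diag(e^t, e^{-t})` and `u_α = [[1, -α],[0,1]]`.  Then the orbit
`(𝒢^n α)_{n ∈ ℕ}` under the Gauss map is equidistributed with respect to the Gauss
measure: for every bounded continuous `f : ℝ → ℝ`,
`(1/N) Σ_{n<N} f (𝒢^n α) → (1/log 2) ∫₀¹ f(x)/(1+x) dx`. -/
theorem gauss_equidistribution_of_flow_equidistribution
    (α : ℝ) (hα : α ∈ Set.Ioo (0 : ℝ) 1)
    (m : Measure (SL 2 ⧸ SLZ 2)) [IsProbabilityMeasure m]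
    (hminv : ∀ g : SL 2, Measure.map (fun x => g • x) m = m)
    (a : ℝ → SL 2)
    (ha : ∀ t, (a t : Matrix (Fin 2) (Fin 2) ℝ) = !![Real.exp t, 0; 0, Real.exp (-t)])
    (u : SL 2)
    (hu : (u : Matrix (Fin 2) (Fin 2) ℝ) = !![1, -α; 0, 1])
    (hequi : ∀ F : BoundedContinuousFunction (SL 2 ⧸ SLZ 2) ℝ,
      Tendsto
        (fun T : ℝ => T⁻¹ * ∫ t in (0 : ℝ)..T,
          F ((a t * u) • ((1 : SL 2) : SL 2 ⧸ SLZ 2)))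
        atTop (𝓝 (∫ x, F x ∂m))) :
    ∀ f : BoundedContinuousFunction ℝ ℝ,
      Tendsto (fun Nn : ℕ => (Nn : ℝ)⁻¹ * ∑ n ∈ Finset.range Nn, f (gaussMap^[n] α)) atTop
        (𝓝 ((Real.log 2)⁻¹ * ∫ x in (0 : ℝ)..1, f x / (1 + x))) := by
  intro f
  obtain ⟨c0, hc0, hlim⟩ := flow_lim m hminv a u hequi
  have hirr := irr_of_lim ha hu hc0 hlim
  have hQ := logQ_tendsto hα hirr
  have hdiv : ∀ g : ℝ → ℝ, Continuous g →
      IntervalIntegrable (fun x => g x / (1 + x)) volume 0 1 := by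
    intro g hg
    apply ContinuousOn.intervalIntegrable
    intro x hx
    rw [Set.uIcc_of_le zero_le_one] at hx
    have : 1 + x ≠ 0 := by linarith [hx.1]
    exact (hg.continuousAt.div (by fun_prop) this).continuousWithinAt
  have hlog : ∫ x in (0 : ℝ)..1, (1 : ℝ) / (1 + x) = Real.log 2 := by
    rw [intervalIntegral.integral_comp_add_left (fun x => 1 / x) 1,
      integral_one_div_of_pos (by norm_num) (by norm_num)]
    norm_num
  have hlog2 : 0 < Real.log 2 := Real.log_pos (by norm_num)
  -- the constant function
  have hone := sum_lim hα hirr ha hu hc0 hlim (f := fun _ => 1) continuous_const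
    (fun _ => zero_le_one) (C := 1) (fun _ => le_rfl)
  rw [region_integral (f := fun _ => 1) continuous_const, hlog] at hone
  have hpos1 : 0 < c0 * (2 * Real.log 2) := by positivity
  -- nonnegative functions
  have key : ∀ g : ℝ → ℝ, Continuous g → (∀ x, 0 ≤ g x) → ∀ C, (∀ x, g x ≤ C) →
      Tendsto (fun Nn : ℕ => (Nn : ℝ)⁻¹ * ∑ n ∈ Finset.range Nn, g (gaussMap^[n] α)) atTop
        (𝓝 ((Real.log 2)⁻¹ * ∫ x in (0 : ℝ)..1, g x / (1 + x))) := by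
    intro g hg hg0 C hC
    have h1 := sum_lim hα hirr ha hu hc0 hlim hg hg0 hC
    rw [region_integral hg] at h1
    have h2 := h1.div hone hpos1.ne'
    have e : c0 * (2 * ∫ x in (0 : ℝ)..1, g x / (1 + x)) / (c0 * (2 * Real.log 2)) =
        (Real.log 2)⁻¹ * ∫ x in (0 : ℝ)..1, g x / (1 + x) := by
      field_simp
    rw [e] at h2
    refine h2.congr' ?_
    filter_upwards [hQ.eventually_gt_atTop 0, eventually_gt_atTop 0] with N hN hN0
    have hK := rhoK_pos.ne'
    have hN' : (N : ℝ) ≠ 0 := by positivity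
    simp only [Pi.div_apply, Finset.sum_const, Finset.card_range, nsmul_eq_mul, mul_one]
    field_simp
  have h3 := key (fun x => f x + ‖f‖) (by fun_prop)
    (fun x => by have := (abs_le.1 (f.norm_coe_le_norm x)).1; linarith) (‖f‖ + ‖f‖)
    (fun x => by have := (abs_le.1 (f.norm_coe_le_norm x)).2; linarith)
  have h4 := h3.sub_const ‖f‖
  have e : (Real.log 2)⁻¹ * (∫ x in (0 : ℝ)..1, (f x + ‖f‖) / (1 + x)) - ‖f‖ =
      (Real.log 2)⁻¹ * ∫ x in (0 : ℝ)..1, f x / (1 + x) := by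
    have : ∫ x in (0 : ℝ)..1, (f x + ‖f‖) / (1 + x) =
        (∫ x in (0 : ℝ)..1, f x / (1 + x)) + ‖f‖ * Real.log 2 := by
      rw [← hlog, ← intervalIntegral.integral_const_mul, ← intervalIntegral.integral_add
        (hdiv f f.continuous) ((hdiv (fun _ => 1) continuous_const).const_mul _)]
      apply intervalIntegral.integral_congr
      intro x _
      simp only
      ring
    rw [this]
    field_simp
    ring
  rw [e] at h4
  refine h4.congr' ?_
  filter_upwards [eventually_gt_atTop 0] with N hN0
  have hN' : (N : ℝ) ≠ 0 := by positivity
  simp only [Finset.sum_add_distrib, Finset.sum_const, Finset.card_range, nsmul_eq_mul]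
  field_simp
  ring
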